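/- arXiv:1501.00051 — 3 statements merged into one kernel-verified Lean document; each statement's English description precedes it below -/
import Mathlib

section
/- Fix a skew shape λ/μ, m ≥ 2, and i ∈ [m−1]. For every reverse plane partition T of shape λ/μ with entries in [m], E_i(r(T)) = r(e_i(T)); in particular e_i(T) = 0 if and only if E_i(r(T)) = 0. -/
/-! ### Crystal operators on words -/

/-- The number of `i`'s minus the number of `(i+1)`'s among the first `k` letters of `w`
(viewing each `i` as a closing parenthesis and each `i+1` as an opening parenthesis). -/
def prefD (i : ℕ) (w : List ℕ) (k : ℕ) : ℤ :=
  ((w.take k).count i : ℤ) - ((w.take k).count (i + 1) : ℤ)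

/-- The number of `(i+1)`'s minus the number of `i`'s in the suffix of `w` starting at
position `k`. -/
def suffD (i : ℕ) (w : List ℕ) (k : ℕ) : ℤ :=
  ((w.drop k).count (i + 1) : ℤ) - ((w.drop k).count i : ℤ)

/-- Position `p` of `w` holds a letter `i` which, viewed as a closing parenthesis
(each `i+1` being an opening parenthesis, all other letters ignored), is unmatched in the
usual parenthesis matching. -/
def IsUnmatchedClose (i : ℕ) (w : List ℕ) (p : ℕ) : Prop :=
  w[p]? = some i ∧ ∀ q ≤ p, prefD i w q < prefD i w (p + 1)

/-- Position `p` of `w` holds a letter `i+1` which, viewed as an opening parenthesis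
(each `i` being a closing parenthesis, all other letters ignored), is unmatched in the
usual parenthesis matching. -/
def IsUnmatchedOpen (i : ℕ) (w : List ℕ) (p : ℕ) : Prop :=
  w[p]? = some (i + 1) ∧ ∀ q ≤ w.length, p < q → suffD i w q < suffD i w p

instance (i : ℕ) (w : List ℕ) (p : ℕ) : Decidable (IsUnmatchedClose i w p) := by
  unfold IsUnmatchedClose; infer_instance

instance (i : ℕ) (w : List ℕ) (p : ℕ) : Decidable (IsUnmatchedOpen i w p) := by
  unfold IsUnmatchedOpen; infer_instance

/-- The (increasing) list of positions of unmatched `i`'s (closing parentheses) of `w`. -/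
def unmatchedCloses (i : ℕ) (w : List ℕ) : List ℕ :=
  (List.range w.length).filter fun p => decide (IsUnmatchedClose i w p)

/-- The (increasing) list of positions of unmatched `(i+1)`'s (opening parentheses) of `w`. -/
def unmatchedOpens (i : ℕ) (w : List ℕ) : List ℕ :=
  (List.range w.length).filter fun p => decide (IsUnmatchedOpen i w p)

/-- The crystal operator `F_i` on words: replace the rightmost unmatched `i` by `i+1`;
`none` (i.e. `0`) if every `i` is matched. -/
def Fop (i : ℕ) (w : List ℕ) : Option (List ℕ) :=
  match (unmatchedCloses i w).getLast? with
  | none => none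
  | some p => some (w.set p (i + 1))

/-- The crystal operator `E_i` on words: replace the leftmost unmatched `i+1` by `i`;
`none` (i.e. `0`) if every `i+1` is matched. -/
def Eop (i : ℕ) (w : List ℕ) : Option (List ℕ) :=
  match (unmatchedOpens i w).head? with
  | none => none
  | some p => some (w.set p i)

/-- `s` is a string over the alphabet `{1, …, m}`. -/
def IsWordOver (m : ℕ) (s : List ℕ) : Prop := ∀ x ∈ s, 1 ≤ x ∧ x ≤ m

/-! ### Skew shapes and reverse plane partitions -/

/-- `(r, c)` is a cell of the skew shape `lam / mu` (matrix convention: `r` = row index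
counted from the top, `c` = column index, both 0-based). -/
def IsSkewCell (lam mu : YoungDiagram) (r c : ℕ) : Prop :=
  (r, c) ∈ lam.cells ∧ (r, c) ∉ mu.cells

instance (lam mu : YoungDiagram) (r c : ℕ) : Decidable (IsSkewCell lam mu r c) := by
  unfold IsSkewCell; infer_instance

/-- `T` is a reverse plane partition of shape `lam / mu` with entries in `{1, …, m}`:
entries weakly increase along rows and columns; `T` is normalized to be `0` outside the
shape. -/
def IsSkewRPP (lam mu : YoungDiagram) (m : ℕ) (T : ℕ → ℕ → ℕ) : Prop :=
  (∀ r c, ¬ IsSkewCell lam mu r c → T r c = 0) ∧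
  (∀ r c, IsSkewCell lam mu r c → 1 ≤ T r c ∧ T r c ≤ m) ∧
  (∀ r c, IsSkewCell lam mu r c → IsSkewCell lam mu r (c + 1) → T r c ≤ T r (c + 1)) ∧
  (∀ r c, IsSkewCell lam mu r c → IsSkewCell lam mu (r + 1) c → T r c ≤ T (r + 1) c)

/-- The reading word of `T`: ignore each entry equal to the entry directly below it, and read
the remaining entries left-to-right, bottom-to-top. -/
def readingWord (lam mu : YoungDiagram) (T : ℕ → ℕ → ℕ) : List ℕ :=
  ((List.range (lam.colLen 0)).reverse).flatMap fun r =>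
    ((List.range (lam.rowLen r)).filter fun c =>
      decide (IsSkewCell lam mu r c) &&
        ! (decide (IsSkewCell lam mu (r + 1) c) && decide (T (r + 1) c = T r c))).map (T r)

/-- The height vector of `T`: the sequence of (1-based) row indices of the entries of `T`
contributing to the reading word, in reading order. -/
def heightWord (lam mu : YoungDiagram) (T : ℕ → ℕ → ℕ) : List ℕ :=
  ((List.range (lam.colLen 0)).reverse).flatMap fun r =>
    ((List.range (lam.rowLen r)).filter fun c =>
      decide (IsSkewCell lam mu r c) &&
        ! (decide (IsSkewCell lam mu (r + 1) c) && decide (T (r + 1) c = T r c))).map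
      fun _ => r + 1

/-! ### Columns, descents and descent-resolution -/

/-- Column `c` of the tableau `T` (of shape `lam/mu`) contains an entry equal to `v`. -/
def ColHasVal (lam mu : YoungDiagram) (T : ℕ → ℕ → ℕ) (c v : ℕ) : Prop :=
  ∃ r ∈ Finset.range (lam.colLen c), IsSkewCell lam mu r c ∧ T r c = v

instance (lam mu : YoungDiagram) (T : ℕ → ℕ → ℕ) (c v : ℕ) :
    Decidable (ColHasVal lam mu T c v) := by
  unfold ColHasVal; infer_instance

/-- Column `c` is `i`-pure: it contains an `i` but no `i+1`. -/
def IsPureLow (i : ℕ) (lam mu : YoungDiagram) (T : ℕ → ℕ → ℕ) (c : ℕ) : Prop :=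
  ColHasVal lam mu T c i ∧ ¬ ColHasVal lam mu T c (i + 1)

/-- Column `c` is `(i+1)`-pure: it contains an `i+1` but no `i`. -/
def IsPureHigh (i : ℕ) (lam mu : YoungDiagram) (T : ℕ → ℕ → ℕ) (c : ℕ) : Prop :=
  ColHasVal lam mu T c (i + 1) ∧ ¬ ColHasVal lam mu T c i

/-- Column `c` is mixed: it contains both an `i` and an `i+1`. -/
def IsMixedCol (i : ℕ) (lam mu : YoungDiagram) (T : ℕ → ℕ → ℕ) (c : ℕ) : Prop :=
  ColHasVal lam mu T c i ∧ ColHasVal lam mu T c (i + 1)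

instance (i : ℕ) (lam mu : YoungDiagram) (T : ℕ → ℕ → ℕ) (c : ℕ) :
    Decidable (IsPureLow i lam mu T c) := by unfold IsPureLow; infer_instance
instance (i : ℕ) (lam mu : YoungDiagram) (T : ℕ → ℕ → ℕ) (c : ℕ) :
    Decidable (IsPureHigh i lam mu T c) := by unfold IsPureHigh; infer_instance

/-- The (0-based) row index of the lowest `i` in column `c`. -/
noncomputable def lowestLow (i : ℕ) (lam mu : YoungDiagram) (T : ℕ → ℕ → ℕ) (c : ℕ) : ℕ :=
  sSup {r | IsSkewCell lam mu r c ∧ T r c = i}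

/-- A descent: the box `(r, c)` contains `i+1` and the box directly to its right contains
`i`. -/
def IsDescent (i : ℕ) (lam mu : YoungDiagram) (T : ℕ → ℕ → ℕ) (r c : ℕ) : Prop :=
  IsSkewCell lam mu r c ∧ IsSkewCell lam mu r (c + 1) ∧ T r c = i + 1 ∧ T r (c + 1) = i

/-- `T` has no descents (for the letters `i`, `i+1`). -/
def NoDescent (i : ℕ) (lam mu : YoungDiagram) (T : ℕ → ℕ → ℕ) : Prop :=
  ∀ r c, ¬ IsDescent i lam mu T r c

/-- The value `v` is `i` or `i+1`. -/
def InBand (i v : ℕ) : Prop := v = i ∨ v = i + 1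

/-- A benign tableau (for the letter `i`): it is `0` outside the shape, all its entries in the
shape are `i` or `i+1`, its entries weakly increase in columns, and for any two mixed columns
`a` (to the left) and `b` (to the right), the lowest `i` of `a` is not in a higher row than
the lowest `i` of `b`. -/
def IsBenign (i : ℕ) (lam mu : YoungDiagram) (T : ℕ → ℕ → ℕ) : Prop :=
  (∀ r c, ¬ IsSkewCell lam mu r c → T r c = 0) ∧
  (∀ r c, IsSkewCell lam mu r c → T r c = i ∨ T r c = i + 1) ∧
  (∀ r c, IsSkewCell lam mu r c → IsSkewCell lam mu (r + 1) c → T r c ≤ T (r + 1) c) ∧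
  (∀ a b, a < b → IsMixedCol i lam mu T a → IsMixedCol i lam mu T b →
    lowestLow i lam mu T a ≤ lowestLow i lam mu T b)

/-- A descent-resolution step at columns `c, c+1` changes no entry outside these two columns,
and no entry whose value is not `i` or `i+1`. -/
def StepFrame (i : ℕ) (lam mu : YoungDiagram) (T T' : ℕ → ℕ → ℕ) (c : ℕ) : Prop :=
  ∀ r c', (¬ (c' = c ∨ c' = c + 1) ∨ ¬ (IsSkewCell lam mu r c' ∧ InBand i (T r c'))) →
    T' r c' = T r c'

/-- Descent-resolution step of type (2M): column `c` is `(i+1)`-pure, column `c+1` is mixed,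
and there is a descent between them; column `c` becomes mixed with its lowest `i` in the same
row as the lowest `i` of column `c+1`, and column `c+1` becomes `(i+1)`-pure. -/
def Step2M (i : ℕ) (lam mu : YoungDiagram) (T T' : ℕ → ℕ → ℕ) (c : ℕ) : Prop :=
  IsPureHigh i lam mu T c ∧ IsMixedCol i lam mu T (c + 1) ∧
  (∃ r, IsDescent i lam mu T r c) ∧ StepFrame i lam mu T T' c ∧
  (∀ r, IsSkewCell lam mu r c → InBand i (T r c) →
    T' r c = if r ≤ lowestLow i lam mu T (c + 1) then i else i + 1) ∧
  (∀ r, IsSkewCell lam mu r (c + 1) → InBand i (T r (c + 1)) → T' r (c + 1) = i + 1)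

/-- Descent-resolution step of type (M1): column `c` is mixed, column `c+1` is `i`-pure,
and there is a descent between them; column `c` becomes `i`-pure, and column `c+1` becomes
mixed with its lowest `i` in the same row as the lowest `i` of column `c`. -/
def StepM1 (i : ℕ) (lam mu : YoungDiagram) (T T' : ℕ → ℕ → ℕ) (c : ℕ) : Prop :=
  IsMixedCol i lam mu T c ∧ IsPureLow i lam mu T (c + 1) ∧
  (∃ r, IsDescent i lam mu T r c) ∧ StepFrame i lam mu T T' c ∧
  (∀ r, IsSkewCell lam mu r c → InBand i (T r c) → T' r c = i) ∧
  (∀ r, IsSkewCell lam mu r (c + 1) → InBand i (T r (c + 1)) →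
    T' r (c + 1) = if r ≤ lowestLow i lam mu T c then i else i + 1)

/-- Descent-resolution step of type (21): column `c` is `(i+1)`-pure, column `c+1` is
`i`-pure, and there is a descent between them; all `i`'s are replaced by `(i+1)`'s and vice
versa in both columns. -/
def Step21 (i : ℕ) (lam mu : YoungDiagram) (T T' : ℕ → ℕ → ℕ) (c : ℕ) : Prop :=
  IsPureHigh i lam mu T c ∧ IsPureLow i lam mu T (c + 1) ∧
  (∃ r, IsDescent i lam mu T r c) ∧ StepFrame i lam mu T T' c ∧
  (∀ r, IsSkewCell lam mu r c → InBand i (T r c) → T' r c = i) ∧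
  (∀ r, IsSkewCell lam mu r (c + 1) → InBand i (T r (c + 1)) → T' r (c + 1) = i + 1)

/-- A descent-resolution step: a step of one of the three types, at some pair of adjacent
columns. -/
def DRStep (i : ℕ) (lam mu : YoungDiagram) (T T' : ℕ → ℕ → ℕ) : Prop :=
  ∃ c, Step2M i lam mu T T' c ∨ StepM1 i lam mu T T' c ∨ Step21 i lam mu T T' c

/-! ### The crystal operators `f_i`, `e_i` on reverse plane partitions -/

/-- The list of pure columns (for the letters `i`, `i+1`), in left-to-right order. -/
def pureCols (i : ℕ) (lam mu : YoungDiagram) (T : ℕ → ℕ → ℕ) : List ℕ :=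
  (List.range (lam.rowLen 0)).filter fun c =>
    decide (IsPureLow i lam mu T c) || decide (IsPureHigh i lam mu T c)

/-- The parenthesis word of the pure columns: each `i`-pure column contributes the letter `i`
(a closing parenthesis) and each `(i+1)`-pure column the letter `i+1` (an opening one). -/
def colWord (i : ℕ) (lam mu : YoungDiagram) (T : ℕ → ℕ → ℕ) : List ℕ :=
  (pureCols i lam mu T).map fun c => if IsPureLow i lam mu T c then i else i + 1

/-- Replace all `i`'s by `(i+1)`'s in column `c`. -/
def raiseCol (i : ℕ) (lam mu : YoungDiagram) (T : ℕ → ℕ → ℕ) (c : ℕ) : ℕ → ℕ → ℕ :=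
  fun r c' => if c' = c ∧ IsSkewCell lam mu r c' ∧ T r c' = i then i + 1 else T r c'

/-- Replace all `(i+1)`'s by `i`'s in column `c`. -/
def lowerCol (i : ℕ) (lam mu : YoungDiagram) (T : ℕ → ℕ → ℕ) (c : ℕ) : ℕ → ℕ → ℕ :=
  fun r c' => if c' = c ∧ IsSkewCell lam mu r c' ∧ T r c' = i + 1 then i else T r c'

/-- `T' = f_i(T)`: the column `c` carrying the rightmost unmatched closing parenthesis (in the
parenthesation of the pure columns) has all its `i`'s replaced by `(i+1)`'s, and then the
descent-resolution algorithm is applied (i.e. descent-resolution steps are performed until no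
descent remains, reaching `T'`). -/
def fiRel (i : ℕ) (lam mu : YoungDiagram) (T T' : ℕ → ℕ → ℕ) : Prop :=
  ∃ p c, (unmatchedCloses i (colWord i lam mu T)).getLast? = some p ∧
    (pureCols i lam mu T)[p]? = some c ∧
    Relation.ReflTransGen (DRStep i lam mu) (raiseCol i lam mu T c) T' ∧
    NoDescent i lam mu T'

/-- `f_i(T) = 0`: every closing parenthesis (i.e. every `i`-pure column) is matched. -/
def fiZero (i : ℕ) (lam mu : YoungDiagram) (T : ℕ → ℕ → ℕ) : Prop :=
  unmatchedCloses i (colWord i lam mu T) = []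

/-- `T' = e_i(T)`: the column `c` carrying the leftmost unmatched opening parenthesis (in the
parenthesation of the pure columns) has all its `(i+1)`'s replaced by `i`'s, and then the
descent-resolution algorithm is applied. -/
def eiRel (i : ℕ) (lam mu : YoungDiagram) (T T' : ℕ → ℕ → ℕ) : Prop :=
  ∃ p c, (unmatchedOpens i (colWord i lam mu T)).head? = some p ∧
    (pureCols i lam mu T)[p]? = some c ∧
    Relation.ReflTransGen (DRStep i lam mu) (lowerCol i lam mu T c) T' ∧
    NoDescent i lam mu T'

/-- `e_i(T) = 0`: every opening parenthesis (i.e. every `(i+1)`-pure column) is matched. -/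
def eiZero (i : ℕ) (lam mu : YoungDiagram) (T : ℕ → ℕ → ℕ) : Prop :=
  unmatchedOpens i (colWord i lam mu T) = []

/-! ### Proof: words -/

namespace RPPProof

/-- every prefix has at least as many `i+1` as `i` -/
def Good (i : ℕ) (v : List ℕ) : Prop := ∀ v1, v1 <+: v → v1.count i ≤ v1.count (i + 1)

lemma unm_iff (i : ℕ) (u v : List ℕ) :
    IsUnmatchedOpen i (u ++ (i + 1) :: v) u.length ↔ Good i v := by
  unfold IsUnmatchedOpen Good suffD
  have h0 : (u ++ (i + 1) :: v)[u.length]? = some (i + 1) := by simp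
  simp only [h0, true_and]
  have hd : ∀ k, (u ++ (i + 1) :: v).drop (u.length + (k + 1)) = v.drop k := by
    intro k
    rw [List.drop_append]
    simp
  have hd0 : (u ++ (i + 1) :: v).drop u.length = (i + 1) :: v := by simp
  have hc : ∀ k a, v.count a = (v.take k).count a + (v.drop k).count a := by
    intro k a
    rw [← List.count_append, List.take_append_drop]
  constructor
  · intro h v1 hv1
    have hv1' : v1 = v.take v1.length := List.prefix_iff_eq_take.mp hv1
    have hl := hv1.length_le
    have := h (u.length + (v1.length + 1)) (by simp; omega) (by omega)
    rw [hd, hd0] at this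
    have e1 := hc v1.length i
    have e2 := hc v1.length (i + 1)
    rw [← hv1'] at e1 e2
    simp at this
    omega
  · intro h q hq hpq
    obtain ⟨k, rfl⟩ : ∃ k, q = u.length + (k + 1) := ⟨q - u.length - 1, by omega⟩
    rw [hd, hd0]
    have e1 := hc k i
    have e2 := hc k (i + 1)
    have := h (v.take k) (List.take_prefix k v)
    simp
    omega

lemma unm_split {i : ℕ} {w : List ℕ} {p : ℕ} (h : w[p]? = some (i + 1)) :
    w = w.take p ++ (i + 1) :: w.drop (p + 1) ∧ (w.take p).length = p := by
  obtain ⟨hp, he⟩ := List.getElem?_eq_some_iff.mp h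
  constructor
  · conv_lhs => rw [← List.take_append_drop p w, List.drop_eq_getElem_cons hp, he]
  · simp; omega

lemma head_iff (i : ℕ) (w : List ℕ) (p : ℕ) :
    (unmatchedOpens i w).head? = some p ↔
      IsUnmatchedOpen i w p ∧ ∀ q < p, ¬ IsUnmatchedOpen i w q := by
  unfold unmatchedOpens
  rw [List.head?_filter, List.find?_range_eq_some]
  simp only [decide_eq_true_eq, List.mem_range, Bool.not_eq_true', decide_eq_false_iff_not]
  constructor
  · rintro ⟨h1, h2, h3⟩
    exact ⟨h1, h3⟩
  · rintro ⟨h1, h3⟩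
    refine ⟨h1, ?_, h3⟩
    by_contra hc
    have := h1.1
    rw [List.getElem?_eq_none (by omega)] at this
    simp at this

lemma nil_iff (i : ℕ) (w : List ℕ) :
    unmatchedOpens i w = [] ↔ ∀ p, ¬ IsUnmatchedOpen i w p := by
  unfold unmatchedOpens
  rw [List.filter_eq_nil_iff]
  simp only [decide_eq_true_eq, List.mem_range]
  constructor
  · intro h p hp
    refine h p ?_ hp
    by_contra hc
    have := hp.1
    rw [List.getElem?_eq_none (by omega)] at this
    simp at this
  · intro h p _
    exact h p

lemma Eop_none_iff (i : ℕ) (w : List ℕ) :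
    Eop i w = none ↔ unmatchedOpens i w = [] := by
  unfold Eop
  cases h : unmatchedOpens i w <;> simp

section lists
variable {α : Type*} {R : α → α → Prop}

/-- `L` sorted; matching data of `L.map f`. -/
lemma no_unm_of (i : ℕ) (L : List α) (f : α → ℕ)
    (h : ∀ A x B, L = A ++ x :: B → f x = i + 1 → ¬ Good i (B.map f)) :
    unmatchedOpens i (L.map f) = [] := by
  rw [nil_iff]
  intro p hp
  obtain ⟨h1, h2⟩ := unm_split hp.1
  obtain ⟨A, l2, hL, hA, hl2⟩ := List.map_eq_append_iff.mp h1
  obtain ⟨x, B, rfl, hx, hB⟩ := List.map_eq_cons_iff.mp hl2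
  have e : L.map f = A.map f ++ (i + 1) :: B.map f := by rw [hL]; simp [hx]
  have hlen : p = (A.map f).length := by rw [hA]; exact h2.symm
  rw [e, hlen, unm_iff] at hp
  exact h A x B hL hx hp

lemma Eop_some_of (i : ℕ) (L : List α) (f : α → ℕ) (A B : List α) (x : α)
    (hL : L = A ++ x :: B) (hx : f x = i + 1) (hG : Good i (B.map f))
    (h : ∀ A1 y A2, A = A1 ++ y :: A2 → f y = i + 1 → ¬ Good i ((A2 ++ x :: B).map f)) :
    Eop i (L.map f) = some (A.map f ++ i :: B.map f) := by
  have hh : (unmatchedOpens i (L.map f)).head? = some A.length := by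
    rw [head_iff]
    have e : L.map f = A.map f ++ (i + 1) :: B.map f := by simp [hL, hx]
    constructor
    · have := (unm_iff i (A.map f) (B.map f)).mpr hG
      rw [e]
      simpa using this
    · intro q hq hu
      have hq' : q < (A.map f).length := by simpa using hq
      have h0 := hu.1
      rw [e, List.getElem?_append_left hq'] at h0
      obtain ⟨h1, h2⟩ := unm_split h0
      obtain ⟨A1, l2, hA, hA1, hl2⟩ := List.map_eq_append_iff.mp h1
      obtain ⟨y, A2, rfl, hy, hA2⟩ := List.map_eq_cons_iff.mp hl2
      have e2 : L.map f = A1.map f ++ (i + 1) :: (A2 ++ x :: B).map f := by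
        simp [hL, hA, hy]
      have hlen : q = (A1.map f).length := by rw [hA1]; exact h2.symm
      rw [e2, hlen, unm_iff] at hu
      exact h A1 y A2 hA hy hu
  unfold Eop
  rw [hh]
  simp [hL]

/-- Converse extraction. -/
lemma head_extract (i : ℕ) (L : List α) (f : α → ℕ) (p : ℕ) (x : α)
    (hp : (unmatchedOpens i (L.map f)).head? = some p) (hx : L[p]? = some x) :
    ∃ A B, L = A ++ x :: B ∧ f x = i + 1 ∧ Good i (B.map f) ∧
    ∀ A1 y A2, A = A1 ++ y :: A2 → f y = i + 1 → ¬ Good i ((A2 ++ x :: B).map f) := by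
  rw [head_iff] at hp
  obtain ⟨hu, hn⟩ := hp
  obtain ⟨hpl, he⟩ := List.getElem?_eq_some_iff.mp hx
  have hfx : f x = i + 1 := by
    have := hu.1
    rw [List.getElem?_map, hx] at this
    simpa using this
  have hL : L = L.take p ++ x :: L.drop (p + 1) := by
    conv_lhs => rw [← List.take_append_drop p L, List.drop_eq_getElem_cons hpl, he]
  have hlen : (L.take p).length = p := by simp; omega
  refine ⟨L.take p, L.drop (p + 1), hL, hfx, ?_, ?_⟩
  · have e : L.map f = (L.take p).map f ++ (i + 1) :: (L.drop (p + 1)).map f := by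
      conv_lhs => rw [hL]
      simp [hfx]
    have hlen2 : p = ((L.take p).map f).length := by simp; omega
    rw [e] at hu
    nth_rewrite 3 [hlen2] at hu
    rwa [unm_iff] at hu
  · intro A1 y A2 hA hy hg
    have e : L.map f = A1.map f ++ (i + 1) :: (A2 ++ x :: L.drop (p + 1)).map f := by
      conv_lhs => rw [hL, hA]
      simp [hy]
    refine hn A1.length ?_ ?_
    · rw [← hlen, hA]; simp
    · have := (unm_iff i (A1.map f) ((A2 ++ x :: L.drop (p + 1)).map f)).mpr hg
      rw [e]
      simpa using this

lemma seg_of_pred [IsTrans α R] [Std.Asymm R] {L A B : List α} {x : α} (hL : L = A ++ x :: B)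
    (hs : L.Pairwise R) (P : α → Prop) (hP : ∀ a b, R a b → P b → P a) :
    ∃ B1, B1 <+: B ∧ ∀ z, z ∈ B1 ↔ z ∈ L ∧ R x z ∧ P z := by
  classical
  subst hL
  rw [List.pairwise_append, List.pairwise_cons] at hs
  obtain ⟨hA, ⟨hxB, hB⟩, hAB⟩ := hs
  refine ⟨B.takeWhile (fun z => decide (P z)), List.takeWhile_prefix _, ?_⟩
  have key : ∀ z, z ∈ B.takeWhile (fun z => decide (P z)) ↔ z ∈ B ∧ P z := by
    clear hxB hAB
    induction B with
    | nil => simp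
    | cons b B ih =>
      rw [List.pairwise_cons] at hB
      intro z
      by_cases hb : P b
      · rw [List.takeWhile_cons_of_pos (by simpa using hb)]
        simp only [List.mem_cons, ih hB.2]
        constructor
        · rintro (rfl | h)
          · exact ⟨Or.inl rfl, hb⟩
          · exact ⟨Or.inr h.1, h.2⟩
        · rintro ⟨rfl | h, h2⟩
          · exact Or.inl rfl
          · exact Or.inr ⟨h, h2⟩
      · rw [List.takeWhile_cons_of_neg (by simpa using hb)]
        simp only [List.mem_cons, List.not_mem_nil, false_iff, not_and]
        rintro (rfl | h) h2
        · exact hb h2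
        · exact hb (hP _ _ (hB.1 z h) h2)
  intro z
  rw [key]
  constructor
  · rintro ⟨h1, h2⟩
    exact ⟨by simp [h1], hxB z h1, h2⟩
  · rintro ⟨h1, h2, h3⟩
    refine ⟨?_, h3⟩
    simp only [List.mem_append, List.mem_cons] at h1
    rcases h1 with h1 | rfl | h1
    · exact absurd h2 (Std.Asymm.asymm _ _ (hAB z h1 x (by simp)))
    · exact absurd h2 (Std.Asymm.asymm _ _ h2)
    · exact h1

lemma seg_of_initial [IsTrans α R] [Std.Asymm R] {L A B : List α} {x : α} (hL : L = A ++ x :: B)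
    (hs : L.Pairwise R) {B0 : List α} {y : α} (hB0 : B0 ++ [y] <+: B) :
    y ∈ L ∧ R x y ∧ ∀ z, z ∈ B0 ++ [y] ↔ z ∈ L ∧ R x z ∧ (z = y ∨ R z y) := by
  obtain ⟨C, rfl⟩ := hB0
  subst hL
  have hs' := hs
  simp only [List.append_assoc, List.singleton_append, List.pairwise_append,
    List.pairwise_cons, List.mem_append, List.mem_cons] at hs
  obtain ⟨hA, ⟨hx, hB0, ⟨hy, hC⟩, hB0C⟩, hAB⟩ := hs
  refine ⟨by simp, hx y (by simp), ?_⟩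
  intro z
  simp only [List.mem_append, List.mem_cons, List.not_mem_nil, or_false]
  constructor
  · rintro (h | rfl)
    · exact ⟨by simp [h], hx z (by simp [h]), Or.inr (hB0C z h y (by simp))⟩
    · exact ⟨by simp, hx z (by simp), Or.inl rfl⟩
  · rintro ⟨h1, h2, rfl | h3⟩
    · exact Or.inr rfl
    · rcases h1 with h1 | rfl | (h1 | h1) | h1
      · exact absurd h2 (Std.Asymm.asymm _ _ (hAB z h1 x (by simp)))
      · exact absurd h2 (Std.Asymm.asymm _ _ h2)
      · exact Or.inl h1
      · exact Or.inr h1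
      · exact absurd h3 (Std.Asymm.asymm _ _ (hy z h1))

lemma count_le {β : Type*} (f : α → ℕ) (v : ℕ) (B1 : List α) (hB1 : B1.Nodup) (g : α → β)
    (S : Finset β) (h : ∀ z ∈ B1, f z = v → g z ∈ S)
    (hinj : ∀ z ∈ B1, ∀ z' ∈ B1, f z = v → f z' = v → g z = g z' → z = z') :
    (B1.map f).count v ≤ S.card := by
  classical
  have e : (B1.map f).count v = (B1.toFinset.filter (fun z => f z = v)).card := by
    rw [List.count, List.countP_map, List.countP_eq_length_filter]
    have : B1.toFinset.filter (fun z => f z = v) =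
        (B1.filter ((fun x => x == v) ∘ f)).toFinset := by
      ext z; simp
    rw [this, List.toFinset_card_of_nodup (hB1.filter _)]
  rw [e]
  refine Finset.card_le_card_of_injOn g ?_ ?_
  · intro z hz
    simp at hz
    exact h z hz.1 hz.2
  · intro z hz z' hz' hg
    simp at hz hz'
    exact hinj z hz.1 z' hz'.1 hz.2 hz'.2 hg

lemma le_count {β : Type*} (f : α → ℕ) (v : ℕ) (B1 : List α) (k : β → α)
    (S : Finset β) (h : ∀ c ∈ S, k c ∈ B1 ∧ f (k c) = v)
    (hinj : ∀ c ∈ S, ∀ c' ∈ S, k c = k c' → c = c') :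
    S.card ≤ (B1.map f).count v := by
  classical
  have e : (B1.toFinset.filter (fun z => f z = v)).card ≤ (B1.map f).count v := by
    rw [List.count, List.countP_map, List.countP_eq_length_filter]
    have : B1.toFinset.filter (fun z => f z = v) =
        (B1.filter ((fun x => x == v) ∘ f)).toFinset := by
      ext z; simp
    rw [this]
    exact List.toFinset_card_le _
  refine le_trans ?_ e
  refine Finset.card_le_card_of_injOn k ?_ ?_
  · intro c hc
    simpa using h c hc
  · intro c hc c' hc' hk
    exact hinj c hc c' hc' hk

end lists
/-! ### Proof: the core on abstract tableaux -/

/-- Abstract form of a reverse plane partition. -/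
structure RP (T : ℕ → ℕ → ℕ) (M N : ℕ) : Prop where
  conv : ∀ {r c r' c' s t}, T r c ≠ 0 → T r' c' ≠ 0 → r ≤ s → s ≤ r' → c ≤ t → t ≤ c' → T s t ≠ 0
  mono : ∀ {r c s t}, r ≤ s → c ≤ t → T r c ≠ 0 → T s t ≠ 0 → T r c ≤ T s t
  bdd : ∀ {r c}, T r c ≠ 0 → r < M ∧ c < N

/-- `(r,c)` is the lowest `v` of column `c`. -/
def IsLow (T : ℕ → ℕ → ℕ) (v r c : ℕ) : Prop := T r c = v ∧ T (r + 1) c ≠ v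

/-- column `c` contains `v` -/
def Has (T : ℕ → ℕ → ℕ) (v c : ℕ) : Prop := ∃ r, T r c = v

/-- columns `c`, `c+1` have an `i+1` in a common row -/
def Link (T : ℕ → ℕ → ℕ) (i c : ℕ) : Prop := ∃ r, T r c = i + 1 ∧ T r (c + 1) = i + 1

section core
variable {T : ℕ → ℕ → ℕ} {M N : ℕ}

lemma exists_low (hT : RP T M N) {v r c : ℕ} (hv : v ≠ 0) (h : T r c = v) :
    ∃ r', r ≤ r' ∧ IsLow T v r' c := by
  by_contra hc
  push Not at hc
  have key : ∀ k, T (r + k) c = v := by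
    intro k
    induction k with
    | zero => simpa using h
    | succ k ih =>
      have := hc (r + k) (by omega)
      unfold IsLow at this
      by_contra hh
      exact this ⟨ih, hh⟩
  have := (hT.bdd (r := r + M) (c := c) (by rw [key]; exact hv)).1
  omega

lemma low_le (hT : RP T M N) {v r r' c : ℕ} (hv : v ≠ 0) (h : IsLow T v r c)
    (h' : T r' c = v) : r' ≤ r := by
  by_contra hc
  push Not at hc
  have n1 : T r c ≠ 0 := by rw [h.1]; exact hv
  have n2 : T r' c ≠ 0 := by rw [h']; exact hv
  have n3 : T (r + 1) c ≠ 0 := hT.conv n1 n2 (by omega) (by omega) le_rfl le_rfl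
  have l1 := hT.mono (by omega : r ≤ r + 1) le_rfl n1 n3
  have l2 := hT.mono (by omega : r + 1 ≤ r') le_rfl n3 n2
  apply h.2
  have := h.1
  omega

lemma low_unique (hT : RP T M N) {v r r' c : ℕ} (hv : v ≠ 0) (h : IsLow T v r c)
    (h' : IsLow T v r' c) : r = r' :=
  le_antisymm (low_le hT hv h' h.1) (low_le hT hv h h'.1)

lemma F1 (hT : RP T M N) {v r c r' c' : ℕ} (hv : v ≠ 0) (h : IsLow T v r c)
    (h' : IsLow T v r' c') (hc : c ≤ c') : r' ≤ r := by
  by_contra hcon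
  push Not at hcon
  have n1 : T r c ≠ 0 := by rw [h.1]; exact hv
  have n2 : T r' c' ≠ 0 := by rw [h'.1]; exact hv
  have n3 : T r' c ≠ 0 := hT.conv n1 n2 (by omega) le_rfl le_rfl hc
  have l1 := hT.mono (by omega : r ≤ r') le_rfl n1 n3
  have l2 := hT.mono le_rfl hc n3 n2
  have e1 := h.1
  have e2 := h'.1
  have := low_le hT hv h (r' := r') (by omega)
  omega

lemma F2 (hT : RP T M N) {i r c r' c' : ℕ} (hi : i ≠ 0) (h : T r c = i + 1)
    (h' : T r' c' = i) (hc : c ≤ c') : r' < r ∨ (r' = r ∧ c' < c) := by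
  by_contra hcon
  have n1 : T r c ≠ 0 := by omega
  have n2 : T r' c' ≠ 0 := by omega
  have l := hT.mono (by omega : r ≤ r') hc n1 n2
  omega

lemma F3 (hT : RP T M N) {i r c r' c' t : ℕ} (hi : i ≠ 0) (h' : IsLow T i r' c')
    (h : T r c = i + 1) (hr : r' < r) (hc1 : c' ≤ t) (hc2 : t ≤ c) : T r t = i + 1 := by
  have n1 : T r c ≠ 0 := by omega
  have n2 : T r' c' ≠ 0 := by rw [h'.1]; exact hi
  have n3 : T r c' ≠ 0 := hT.conv n2 n1 (by omega) le_rfl le_rfl (by omega)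
  have n4 : T r t ≠ 0 := hT.conv n2 n1 (by omega) le_rfl hc1 hc2
  have l1 := hT.mono hr.le le_rfl n2 n3
  have l2 := hT.mono le_rfl hc1 n3 n4
  have l3 := hT.mono le_rfl hc2 n4 n1
  have e := h'.1
  have : T r c' ≠ i := by
    intro hh
    have := low_le hT hi h' hh
    omega
  omega

/-- reading order on cells -/
def Bef (a b : ℕ × ℕ) : Prop := b.1 < a.1 ∨ (b.1 = a.1 ∧ a.2 < b.2)

instance : IsTrans (ℕ × ℕ) Bef := ⟨by unfold Bef; intros; omega⟩
instance : Std.Asymm Bef := ⟨by unfold Bef; intros; omega⟩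

open Classical in
/-- number of opening minus number of closing brackets of column `c` -/
noncomputable def del (T : ℕ → ℕ → ℕ) (i c : ℕ) : ℤ :=
  (if Has T (i + 1) c then 1 else 0) - (if Has T i c then 1 else 0)

/-- sum of `del` over `[x, y)` -/
noncomputable def Dl (T : ℕ → ℕ → ℕ) (i x y : ℕ) : ℤ := ∑ c ∈ Finset.Ico x y, del T i c

open Classical in
/-- columns in `[x,y)` containing `v` -/
noncomputable def colsIn (T : ℕ → ℕ → ℕ) (v x y : ℕ) : Finset ℕ :=
  (Finset.Ico x y).filter (fun c => Has T v c)

lemma mem_colsIn {v x y c : ℕ} : c ∈ colsIn T v x y ↔ (x ≤ c ∧ c < y) ∧ Has T v c := by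
  simp [colsIn]

lemma Dl_eq (i x y : ℕ) :
    Dl T i x y = ((colsIn T (i + 1) x y).card : ℤ) - (colsIn T i x y).card := by
  unfold Dl del colsIn
  rw [Finset.sum_sub_distrib]
  simp

lemma Dl_add {i x y z : ℕ} (h1 : x ≤ y) (h2 : y ≤ z) :
    Dl T i x z = Dl T i x y + Dl T i y z := by
  unfold Dl
  rw [Finset.sum_Ico_consecutive _ h1 h2]

lemma Dl_single (i x : ℕ) : Dl T i x (x + 1) = del T i x := by simp [Dl]

lemma Dl_mixed {i x y : ℕ} (h : ∀ c, x ≤ c → c < y → Has T i c ∧ Has T (i + 1) c) :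
    Dl T i x y = 0 := by
  unfold Dl
  apply Finset.sum_eq_zero
  intro c hc
  rw [Finset.mem_Ico] at hc
  have := h c hc.1 hc.2
  simp [del, this.1, this.2]

lemma card_cons {v x y : ℕ} (hxy : x < y) (h : Has T v x) :
    (colsIn T v x y).card = (colsIn T v (x + 1) y).card + 1 := by
  have : colsIn T v x y = insert x (colsIn T v (x + 1) y) := by
    ext c
    simp only [mem_colsIn, Finset.mem_insert]
    constructor
    · rintro ⟨h1, h2⟩
      by_cases hc : c = x
      · exact Or.inl hc
      · exact Or.inr ⟨by omega, h2⟩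
    · rintro (rfl | ⟨h1, h2⟩)
      · exact ⟨by omega, h⟩
      · exact ⟨by omega, h2⟩
  rw [this, Finset.card_insert_of_notMem]
  simp [mem_colsIn]

/-- `L` is the list of cells read in the reading word. -/
structure IsRL (T : ℕ → ℕ → ℕ) (L : List (ℕ × ℕ)) : Prop where
  sorted : L.Pairwise Bef
  mem : ∀ r c, (r, c) ∈ L ↔ T r c ≠ 0 ∧ T (r + 1) c ≠ T r c

lemma IsRL.low {L : List (ℕ × ℕ)} (h : IsRL T L) {v : ℕ} (hv : v ≠ 0) {z : ℕ × ℕ} :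
    (z ∈ L ∧ T z.1 z.2 = v) ↔ IsLow T v z.1 z.2 := by
  obtain ⟨r, c⟩ := z
  rw [h.mem]
  unfold IsLow
  constructor
  · rintro ⟨⟨h1, h2⟩, h3⟩
    exact ⟨h3, fun h4 => h2 (h4.trans h3.symm)⟩
  · rintro ⟨h3, h4⟩
    simp at h3 h4
    refine ⟨⟨by omega, by omega⟩, h3⟩

lemma bef_nodup {L : List (ℕ × ℕ)} (h : L.Pairwise Bef) : L.Nodup := by
  refine h.imp ?_
  rintro a b hab rfl
  unfold Bef at hab
  omega

/-- The `i+1` of column `d` is unmatched. -/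
lemma main_good (hT : RP T M N) {L : List (ℕ × ℕ)} (hL : IsRL T L) {i : ℕ} (hi : i ≠ 0)
    {d c0 b : ℕ} (hd : d ≤ c0) (hch : ∀ c, d ≤ c → c < c0 → Has T i c ∧ Has T (i + 1) c ∧ Link T i c)
    (h0 : Has T (i + 1) c0)
    (hnl : ∀ e, e + 1 = d → ¬ Link T i e)
    (hun : ∀ y, c0 < y → 0 < Dl T i c0 y)
    (hb : IsLow T (i + 1) b d) {A B : List (ℕ × ℕ)} (hdec : L = A ++ (b, d) :: B) :
    Good i (B.map (fun z => T z.1 z.2)) := by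
  classical
  have hi1 : i + 1 ≠ 0 := by omega
  have hLnd := bef_nodup hL.sorted
  intro v1 hv1
  obtain ⟨B1, hB1, rfl⟩ : ∃ B1, B1 <+: B ∧ v1 = B1.map (fun z => T z.1 z.2) := by
    refine ⟨B.take v1.length, List.take_prefix _ _, ?_⟩
    rw [List.map_take]
    exact List.prefix_iff_eq_take.mp hv1
  clear hv1
  induction B1 using List.reverseRecOn with
  | nil => simp
  | append_singleton B0 y ih =>
    have hB0 := ih ((List.prefix_append _ _).trans hB1)
    by_cases hy : T y.1 y.2 = i
    swap
    · have e1 : List.count i (List.map (fun z : ℕ × ℕ => T z.1 z.2) (B0 ++ [y])) =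
          List.count i (List.map (fun z : ℕ × ℕ => T z.1 z.2) B0) := by
        simp [List.count_append, hy]
      have e2 : List.count (i+1) (List.map (fun z : ℕ × ℕ => T z.1 z.2) B0) ≤
          List.count (i+1) (List.map (fun z : ℕ × ℕ => T z.1 z.2) (B0 ++ [y])) := by
        simp [List.count_append]
      omega
    obtain ⟨hyL, hxy, hmem⟩ := seg_of_initial hdec hL.sorted hB1
    have hylow : IsLow T i y.1 y.2 := (hL.low hi).mp ⟨hyL, hy⟩
    obtain ⟨ry, cy⟩ := y
    simp only at hy hylow
    have hnd : (B0 ++ [(ry, cy)]).Nodup := by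
      have h1 : ((b, d) :: B).Nodup := by
        rw [hdec] at hLnd
        exact (List.nodup_append.mp hLnd).2.1
      exact (List.nodup_cons.mp h1).2.sublist hB1.sublist
    -- closes lie in `[d, cy]`
    have hclose : ∀ r z, IsLow T i r z → Bef (b, d) (r, z) → d ≤ z := by
      intro r z hz hbz
      by_contra hcon
      push Not at hcon
      unfold Bef at hbz
      simp only at hbz
      have hrb : r < b := by omega
      refine hnl (d - 1) (by omega) ⟨b, ?_, ?_⟩
      · exact F3 hT hi hz hb.1 hrb (by omega) (by omega)
      · rw [Nat.sub_add_cancel (by omega)]; exact hb.1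
    have hdy : d ≤ cy := hclose _ _ hylow hxy
    have c1 : (List.map (fun z : ℕ × ℕ => T z.1 z.2) (B0 ++ [(ry, cy)])).count i ≤
        (colsIn T i d (cy + 1)).card := by
      refine count_le _ _ _ hnd Prod.snd _ ?_ ?_
      · rintro ⟨r, z⟩ hz hfz
        simp only at hfz
        obtain ⟨hzL, hz1, hz2⟩ := (hmem _).mp hz
        have hzl : IsLow T i r z := (hL.low hi (z := (r, z))).mp ⟨hzL, hfz⟩
        rw [mem_colsIn]
        refine ⟨⟨hclose _ _ hzl hz1, ?_⟩, r, hfz⟩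
        by_contra hcon
        have := F1 hT hi hylow hzl (by simp at hcon; omega)
        rcases hz2 with hz2 | hz2
        · simp at hz2 hcon; omega
        · unfold Bef at hz2; simp at hz2 hcon; omega
      · rintro ⟨r, z⟩ hz ⟨r', z'⟩ hz' hf hf' hg
        simp only at hg hf hf'
        subst hg
        have := low_unique hT hi ((hL.low hi (z := (r, z))).mp ⟨((hmem _).mp hz).1, hf⟩)
          ((hL.low hi (z := (r', z))).mp ⟨((hmem _).mp hz').1, hf'⟩)
        exact Prod.ext this rfl
    have hopen : ∀ y', (∀ c, d < c → c < y' → ∀ r, IsLow T (i + 1) r c → Bef (r, c) (ry, cy)) →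
        (colsIn T (i + 1) (d + 1) y').card ≤
        (List.map (fun z : ℕ × ℕ => T z.1 z.2) (B0 ++ [(ry, cy)])).count (i + 1) := by
      intro y' hy'
      have hex : ∀ c, ∃ r, Has T (i + 1) c → IsLow T (i + 1) r c := by
        intro c
        by_cases hc : Has T (i + 1) c
        · obtain ⟨r, hr⟩ := hc
          obtain ⟨r', _, h'⟩ := exists_low hT hi1 hr
          exact ⟨r', fun _ => h'⟩
        · exact ⟨0, fun h => absurd h hc⟩
      choose h hh using hex
      refine le_count _ _ _ (fun c => (h c, c)) _ ?_ ?_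
      · intro c hc
        rw [mem_colsIn] at hc
        have hlow := hh c hc.2
        refine ⟨?_, hlow.1⟩
        rw [hmem]
        refine ⟨((hL.low hi1 (z := (h c, c))).mpr hlow).1, ?_,
          Or.inr (hy' c (by omega) hc.1.2 _ hlow)⟩
        have := F1 hT hi1 hb hlow (by omega)
        unfold Bef
        simp only
        omega
      · intro c _ c' _ hcc
        exact (Prod.mk.inj hcc).2
    have hF2 : ∀ c, c < cy + 1 → ∀ r, IsLow T (i + 1) r c → Bef (r, c) (ry, cy) := by
      intro c hc r hr
      have := F2 hT hi hr.1 hy (by omega)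
      unfold Bef
      simp only
      omega
    by_cases hyc : cy < c0
    · have c2 := hopen (cy + 2) (by
        intro c hc hc2 r hr
        by_cases hcc : c < cy + 1
        · exact hF2 c hcc r hr
        · obtain rfl : c = cy + 1 := by omega
          obtain ⟨_, _, s, hs1, hs2⟩ := hch cy hdy hyc
          have l1 := low_le hT hi1 hr hs2
          have l2 := F2 hT hi hs1 hy le_rfl
          left
          simp only
          omega)
      have e1 : (colsIn T i d (cy + 1)).card ≤ cy + 1 - d := by
        have := Finset.card_filter_le (Finset.Ico d (cy + 1)) (fun c => Has T i c)
        rw [Nat.card_Ico] at this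
        exact this
      have e2 : colsIn T (i + 1) (d + 1) (cy + 2) = Finset.Ico (d + 1) (cy + 2) := by
        unfold colsIn
        rw [Finset.filter_true_of_mem]
        intro c hc
        rw [Finset.mem_Ico] at hc
        by_cases hcc : c < c0
        · exact (hch c (by omega) hcc).2.1
        · obtain rfl : c = c0 := by omega
          exact h0
      rw [e2, Nat.card_Ico] at c2
      omega
    · have c2 := hopen (cy + 1) (fun c _ hc => hF2 c hc)
      have e1 := card_cons (T := T) (v := i + 1) (x := d) (y := cy + 1) (by omega) ⟨b, hb.1⟩
      have e2 := Dl_eq (T := T) i d (cy + 1)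
      rw [Dl_add hd (by omega), Dl_mixed (fun c h1 h2 => ⟨(hch c h1 h2).1, (hch c h1 h2).2.1⟩)] at e2
      have := hun (cy + 1) (by omega)
      omega

/-- A matching closing bracket for the `i+1` of column `x`. -/
lemma exists_match (hT : RP T M N) {i : ℕ} (hi : i ≠ 0) {d : ℕ}
    (hP : ∀ x, x < d → Has T (i + 1) x → ¬ Has T i x →
      ∃ y, x ≤ y ∧ y < d ∧ Has T i y ∧ ¬ Has T (i + 1) y ∧ Dl T i x (y + 1) ≤ 0)
    (hQ : ∀ x, x < d → Link T i x → x + 1 < d) :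
    ∀ n x, x + n = d → Has T (i + 1) x → x < d → ∃ y, x ≤ y ∧ Has T i y ∧ Dl T i x (y + 1) ≤ 0 ∧
      ∀ c r ry, y < c → IsLow T i ry y → IsLow T (i + 1) r c → r ≤ ry := by
  intro n
  induction n with
  | zero => intros; omega
  | succ n ih =>
    intro x hx hH hxd
    by_cases hLo : Has T i x
    · by_cases hg : ∀ c r ry, x < c → IsLow T i ry x → IsLow T (i + 1) r c → r ≤ ry
      · refine ⟨x, le_rfl, hLo, ?_, hg⟩
        rw [Dl_single]
        simp [del, hLo, hH]
      · push Not at hg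
        obtain ⟨c, r, ry, hxc, hry, hr, hlt⟩ := hg
        have l : Link T i x := ⟨r, F3 hT hi hry hr.1 hlt le_rfl (by omega),
          F3 hT hi hry hr.1 hlt (by omega) (by omega)⟩
        have hx1 := hQ x hxd l
        obtain ⟨s, hs1, hs2⟩ := l
        obtain ⟨y, h1, h2, h3, h4⟩ := ih (x + 1) (by omega) ⟨s, hs2⟩ hx1
        refine ⟨y, by omega, h2, ?_, h4⟩
        rw [Dl_add (y := x + 1) (by omega) (by omega), Dl_single]
        simp [del, hLo, hH, h3]
    · obtain ⟨y, h1, h2, h3, h4, h5⟩ := hP x hxd hH hLo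
      refine ⟨y, h1, h3, h5, ?_⟩
      intro c r ry hc hry hr
      by_contra hcon
      exact h4 ⟨r, F3 hT hi hry hr.1 (by omega) le_rfl (by omega)⟩

/-- The `i+1` of column `x` is matched. -/
lemma main_not_good (hT : RP T M N) {L : List (ℕ × ℕ)} (hL : IsRL T L) {i : ℕ} (hi : i ≠ 0)
    {b x y : ℕ} (hb : IsLow T (i + 1) b x) (hxy : x ≤ y) (hy : Has T i y)
    (hD : Dl T i x (y + 1) ≤ 0)
    (hg : ∀ c r ry, y < c → IsLow T i ry y → IsLow T (i + 1) r c → r ≤ ry)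
    {A B : List (ℕ × ℕ)} (hdec : L = A ++ (b, x) :: B) :
    ¬ Good i (B.map (fun z => T z.1 z.2)) := by
  classical
  have hi1 : i + 1 ≠ 0 := by omega
  have hLnd := bef_nodup hL.sorted
  obtain ⟨ry, hylow⟩ : ∃ ry, IsLow T i ry y := by
    obtain ⟨r, hr⟩ := hy
    obtain ⟨r', _, h'⟩ := exists_low hT hi hr
    exact ⟨r', h'⟩
  obtain ⟨B1, hB1, hmem⟩ := seg_of_pred hdec hL.sorted (fun z => z = (ry, y) ∨ Bef z (ry, y)) (by
    rintro a b hab (rfl | h)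
    · exact Or.inr hab
    · exact Or.inr (IsTrans.trans _ _ _ hab h))
  intro hG
  have h1 := hG _ (hB1.map (fun z : ℕ × ℕ => T z.1 z.2))
  have hnd : B1.Nodup := by
    have h1 : ((b, x) :: B).Nodup := by
      rw [hdec] at hLnd
      exact (List.nodup_append.mp hLnd).2.1
    exact (List.nodup_cons.mp h1).2.sublist hB1.sublist
  have c1 : (List.map (fun z : ℕ × ℕ => T z.1 z.2) B1).count (i + 1) ≤
      (colsIn T (i + 1) (x + 1) (y + 1)).card := by
    refine count_le _ _ _ hnd Prod.snd _ ?_ ?_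
    · rintro ⟨r, z⟩ hz hfz
      simp only at hfz
      obtain ⟨hzL, hz1, hz2⟩ := (hmem _).mp hz
      have hzl : IsLow T (i + 1) r z := (hL.low hi1 (z := (r, z))).mp ⟨hzL, hfz⟩
      rw [mem_colsIn]
      refine ⟨⟨?_, ?_⟩, r, hfz⟩
      · by_contra hcon
        have := F1 hT hi1 hzl hb (by simp at hcon; omega)
        unfold Bef at hz1
        simp at hz1 hcon
        omega
      · by_contra hcon
        have := hg z r ry (by simp at hcon; omega) hylow hzl
        rcases hz2 with hz2 | hz2
        · simp at hz2 hcon; omega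
        · unfold Bef at hz2; simp at hz2 hcon; omega
    · rintro ⟨r, z⟩ hz ⟨r', z'⟩ hz' hf hf' hg
      simp only at hg hf hf'
      subst hg
      have := low_unique hT hi1 ((hL.low hi1 (z := (r, z))).mp ⟨((hmem _).mp hz).1, hf⟩)
        ((hL.low hi1 (z := (r', z))).mp ⟨((hmem _).mp hz').1, hf'⟩)
      exact Prod.ext this rfl
  have c2 : (colsIn T i x (y + 1)).card ≤
      (List.map (fun z : ℕ × ℕ => T z.1 z.2) B1).count i := by
    have hex : ∀ c, ∃ r, Has T i c → IsLow T i r c := by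
      intro c
      by_cases hc : Has T i c
      · obtain ⟨r, hr⟩ := hc
        obtain ⟨r', _, h'⟩ := exists_low hT hi hr
        exact ⟨r', fun _ => h'⟩
      · exact ⟨0, fun h => absurd h hc⟩
    choose h hh using hex
    refine le_count _ _ _ (fun c => (h c, c)) _ ?_ ?_
    · intro c hc
      rw [mem_colsIn] at hc
      have hlow := hh c hc.2
      refine ⟨?_, hlow.1⟩
      rw [hmem]
      refine ⟨((hL.low hi (z := (h c, c))).mpr hlow).1, ?_, ?_⟩
      · have := F2 hT hi hb.1 hlow.1 (by omega)
        unfold Bef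
        simp only
        omega
      · have l1 := F1 hT hi hlow hylow (by omega)
        by_cases hcy : c = y
        · left
          subst hcy
          rw [low_unique hT hi hlow hylow]
        · right
          unfold Bef
          simp only
          omega
    · intro c _ c' _ hcc
      exact (Prod.mk.inj hcc).2
  have e1 := card_cons (T := T) (v := i + 1) (x := x) (y := y + 1) (by omega) ⟨b, hb.1⟩
  have e2 := Dl_eq (T := T) i x (y + 1)
  omega

end core
/-! ### Proof: the word of pure columns -/
section cols
variable {T : ℕ → ℕ → ℕ} {M N : ℕ}

/-- `L` is the list of pure columns -/
structure IsPL (T : ℕ → ℕ → ℕ) (i : ℕ) (L : List ℕ) : Prop where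
  sorted : L.Pairwise (· < ·)
  mem : ∀ c, c ∈ L ↔ (Has T i c ∧ ¬ Has T (i + 1) c) ∨ (Has T (i + 1) c ∧ ¬ Has T i c)

open Classical in
lemma Dl_pure (i x y : ℕ) : Dl T i x y =
    (((Finset.Ico x y).filter (fun c => Has T (i + 1) c ∧ ¬ Has T i c)).card : ℤ) -
    ((Finset.Ico x y).filter (fun c => Has T i c ∧ ¬ Has T (i + 1) c)).card := by
  unfold Dl
  rw [Finset.card_filter, Finset.card_filter]
  push_cast
  rw [← Finset.sum_sub_distrib]
  refine Finset.sum_congr rfl ?_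
  intro c _
  unfold del
  by_cases h1 : Has T i c <;> by_cases h2 : Has T (i + 1) c <;> simp [h1, h2]

lemma col_count {i : ℕ} {L : List ℕ} (hL : IsPL T i L) {f : ℕ → ℕ}
    (hf1 : ∀ c ∈ L, Has T i c → f c = i) (hf2 : ∀ c ∈ L, ¬ Has T i c → f c = i + 1)
    {x y : ℕ} {B1 : List ℕ} (hnd : B1.Nodup) (hmem : ∀ z, z ∈ B1 ↔ z ∈ L ∧ x < z ∧ z < y) :
    Dl T i (x + 1) y = ((B1.map f).count (i + 1) : ℤ) - (B1.map f).count i := by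
  classical
  rw [Dl_pure]
  have e1 : ((Finset.Ico (x + 1) y).filter (fun c => Has T (i + 1) c ∧ ¬ Has T i c)).card =
      (B1.map f).count (i + 1) := by
    apply le_antisymm
    · refine le_count _ _ _ id _ ?_ (by simp)
      intro c hc
      simp only [Finset.mem_filter, Finset.mem_Ico] at hc
      have hcL : c ∈ L := (hL.mem c).mpr (Or.inr hc.2)
      exact ⟨(hmem c).mpr ⟨hcL, by omega⟩, hf2 c hcL hc.2.2⟩
    · refine count_le _ _ _ hnd id _ ?_ (by simp)
      intro c hc hfc
      obtain ⟨h1, h2⟩ := (hmem c).mp hc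
      simp only [Finset.mem_filter, Finset.mem_Ico, id]
      refine ⟨by omega, ?_⟩
      have hn : ¬ Has T i c := by
        intro hh
        have := hf1 c h1 hh
        omega
      rcases (hL.mem c).mp h1 with h | h
      · exact absurd h.1 hn
      · exact h
  have e2 : ((Finset.Ico (x + 1) y).filter (fun c => Has T i c ∧ ¬ Has T (i + 1) c)).card =
      (B1.map f).count i := by
    apply le_antisymm
    · refine le_count _ _ _ id _ ?_ (by simp)
      intro c hc
      simp only [Finset.mem_filter, Finset.mem_Ico] at hc
      have hcL : c ∈ L := (hL.mem c).mpr (Or.inl hc.2)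
      exact ⟨(hmem c).mpr ⟨hcL, by omega⟩, hf1 c hcL hc.2.1⟩
    · refine count_le _ _ _ hnd id _ ?_ (by simp)
      intro c hc hfc
      obtain ⟨h1, h2⟩ := (hmem c).mp hc
      simp only [Finset.mem_filter, Finset.mem_Ico, id]
      refine ⟨by omega, ?_⟩
      have hn : Has T i c := by
        by_contra hh
        have := hf2 c h1 hh
        omega
      rcases (hL.mem c).mp h1 with h | h
      · exact h
      · exact absurd hn h.2
  rw [e1, e2]

lemma col_good_iff {i : ℕ} {L : List ℕ} (hL : IsPL T i L) {f : ℕ → ℕ}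
    (hf1 : ∀ c ∈ L, Has T i c → f c = i) (hf2 : ∀ c ∈ L, ¬ Has T i c → f c = i + 1)
    {x : ℕ} {A B : List ℕ} (hdec : L = A ++ x :: B) (hx : f x = i + 1) :
    (Has T (i + 1) x ∧ ¬ Has T i x) ∧ (Good i (B.map f) ↔ ∀ y, x < y → 0 < Dl T i x y) := by
  have hxL : x ∈ L := by rw [hdec]; simp
  have hxi : ¬ Has T i x := fun h => by have := hf1 x hxL h; omega
  have hxh : Has T (i + 1) x := by
    rcases (hL.mem x).mp hxL with h | h
    · exact absurd h.1 hxi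
    · exact h.1
  have hdel : del T i x = 1 := by simp [del, hxi, hxh]
  have hBnd : B.Nodup := by
    have h1 : L.Nodup := hL.sorted.imp (fun h => Nat.ne_of_lt h)
    rw [hdec] at h1
    exact (List.nodup_cons.mp (List.nodup_append.mp h1).2.1).2
  refine ⟨⟨hxh, hxi⟩, ?_, ?_⟩
  · intro hG y hxy
    obtain ⟨B1, hB1, hmem⟩ := seg_of_pred hdec hL.sorted (fun z => z < y) (by intros; omega)
    have hc := col_count hL hf1 hf2 (hBnd.sublist hB1.sublist) hmem
    have hg := hG _ (hB1.map f)
    rw [Dl_add (y := x + 1) (by omega) (by omega), Dl_single, hdel]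
    omega
  · intro h v1 hv1
    obtain ⟨B1, hB1, rfl⟩ : ∃ B1, B1 <+: B ∧ v1 = B1.map f := by
      refine ⟨B.take v1.length, List.take_prefix _ _, ?_⟩
      rw [List.map_take]
      exact List.prefix_iff_eq_take.mp hv1
    rcases List.eq_nil_or_concat B1 with rfl | ⟨B0, y, rfl⟩
    · simp
    · rw [List.concat_eq_append] at *
      obtain ⟨hyL, hxy, hmem⟩ := seg_of_initial hdec hL.sorted hB1
      have hc := col_count hL hf1 hf2 (x := x) (y := y + 1) (hBnd.sublist hB1.sublist) (by
        intro z
        rw [hmem]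
        constructor
        · rintro ⟨h1, h2, h3⟩; exact ⟨h1, h2, by omega⟩
        · rintro ⟨h1, h2, h3⟩; exact ⟨h1, h2, by omega⟩)
      have := h (y + 1) (by omega)
      rw [Dl_add (y := x + 1) (by omega) (by omega), Dl_single, hdel] at this
      omega

/-- `c0` is the leftmost unmatched `i+1`-pure column -/
structure Leftmost (T : ℕ → ℕ → ℕ) (i c0 : ℕ) : Prop where
  high : Has T (i + 1) c0
  nlow : ¬ Has T i c0
  pos : ∀ y, c0 < y → 0 < Dl T i c0 y
  left : ∀ x, x < c0 → Has T (i + 1) x → ¬ Has T i x → ∃ y, x < y ∧ Dl T i x y ≤ 0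

lemma leftmost_of {i : ℕ} {L : List ℕ} (hL : IsPL T i L) {f : ℕ → ℕ}
    (hf1 : ∀ c ∈ L, Has T i c → f c = i) (hf2 : ∀ c ∈ L, ¬ Has T i c → f c = i + 1)
    {p c0 : ℕ} (hp : (unmatchedOpens i (L.map f)).head? = some p) (hc0 : L[p]? = some c0) :
    Leftmost T i c0 := by
  obtain ⟨A, B, hdec, hfx, hG, hn⟩ := head_extract i L f p c0 hp hc0
  obtain ⟨⟨h1, h2⟩, h3⟩ := col_good_iff hL hf1 hf2 hdec hfx
  refine ⟨h1, h2, h3.mp hG, ?_⟩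
  intro x hx hxh hxl
  have hxL : x ∈ L := (hL.mem x).mpr (Or.inr ⟨hxh, hxl⟩)
  have hxA : x ∈ A := by
    have hs := hL.sorted
    rw [hdec] at hxL hs
    simp only [List.mem_append, List.mem_cons] at hxL
    rcases hxL with h | h | h
    · exact h
    · omega
    · rw [List.pairwise_append, List.pairwise_cons] at hs
      have := hs.2.1.1 x h
      omega
  obtain ⟨A1, A2, rfl⟩ := List.append_of_mem hxA
  have hfx' := hf2 x hxL hxl
  have hng := hn A1 x A2 rfl hfx'
  rw [(col_good_iff hL hf1 hf2 (A := A1) (B := A2 ++ c0 :: B) (by rw [hdec]; simp) hfx').2] at hng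
  push Not at hng
  exact hng

lemma all_matched_of {i : ℕ} {L : List ℕ} (hL : IsPL T i L) {f : ℕ → ℕ}
    (hf1 : ∀ c ∈ L, Has T i c → f c = i) (hf2 : ∀ c ∈ L, ¬ Has T i c → f c = i + 1)
    (hp : unmatchedOpens i (L.map f) = []) :
    ∀ x, Has T (i + 1) x → ¬ Has T i x → ∃ y, x < y ∧ Dl T i x y ≤ 0 := by
  intro x hxh hxl
  have hxL : x ∈ L := (hL.mem x).mpr (Or.inr ⟨hxh, hxl⟩)
  have hfx' := hf2 x hxL hxl
  obtain ⟨A1, A2, hdec⟩ := List.append_of_mem hxL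
  rw [nil_iff] at hp
  have h := hp (A1.map f).length
  have e : L.map f = A1.map f ++ (i + 1) :: A2.map f := by rw [hdec]; simp [hfx']
  rw [e, unm_iff, (col_good_iff hL hf1 hf2 hdec hfx').2] at h
  push Not at h
  exact h

/-- The first place where the partial sums become nonpositive is a pure closing column. -/
lemma first_close {i x : ℕ} (hxh : Has T (i + 1) x) (hxl : ¬ Has T i x)
    (h : ∃ y, x < y ∧ Dl T i x y ≤ 0) :
    ∃ y, x ≤ y ∧ Has T i y ∧ ¬ Has T (i + 1) y ∧ Dl T i x (y + 1) ≤ 0 ∧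
      ∀ z, x < z → z ≤ y → 0 < Dl T i x z := by
  classical
  have hdel : del T i x = 1 := by simp [del, hxh, hxl]
  obtain ⟨h1, h2⟩ := Nat.find_spec h
  have h3 := fun z (hz : z < Nat.find h) => Nat.find_min h hz
  generalize Nat.find h = Y at h1 h2 h3
  have hY : Y ≠ x + 1 := by
    rintro rfl
    rw [Dl_single] at h2
    omega
  obtain ⟨y, rfl⟩ : ∃ y, Y = y + 1 := ⟨Y - 1, by omega⟩
  have hpos : ∀ z, x < z → z ≤ y → 0 < Dl T i x z := by
    intro z hz1 hz2
    have := h3 z (by omega)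
    push Not at this
    exact this hz1
  have hy := hpos y (by omega) le_rfl
  have h2' := h2
  rw [Dl_add (y := y) (by omega) (by omega), Dl_single] at h2'
  have hneg : del T i y < 0 := by omega
  refine ⟨y, by omega, ?_, ?_, h2, hpos⟩
  · by_contra hh
    simp [del, hh] at hneg
    split_ifs at hneg <;> omega
  · intro hh
    simp [del, hh] at hneg
    split_ifs at hneg <;> omega

end cols

section chain
variable {T : ℕ → ℕ → ℕ} {M N : ℕ}

/-- the columns `d, …, c0-1` are mixed and linked to their right neighbours -/
def Chain (T : ℕ → ℕ → ℕ) (i c0 d : ℕ) : Prop :=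
  d ≤ c0 ∧ ∀ c, d ≤ c → c < c0 → Has T i c ∧ Has T (i + 1) c ∧ Link T i c

lemma chain_no_pure {i c0 d e : ℕ} (h0 : Leftmost T i c0) (hc : Chain T i c0 d) (he : e + 1 = d)
    (hh : Has T (i + 1) e) : Has T i e := by
  by_contra hl
  obtain ⟨y, hy, hD⟩ := h0.left e (by have := hc.1; omega) hh hl
  have hdel : del T i e = 1 := by simp [del, hh, hl]
  have hmix : ∀ z, z ≤ c0 → Dl T i d z = 0 := fun z hz =>
    Dl_mixed (fun c h1 h2 => ⟨(hc.2 c h1 (by omega)).1, (hc.2 c h1 (by omega)).2.1⟩)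
  rw [Dl_add (y := d) (by omega) (by omega), ← he, Dl_single, he, hdel] at hD
  by_cases hyc : y ≤ c0
  · rw [hmix y hyc] at hD; omega
  · have := h0.pos y (by omega)
    rw [Dl_add (y := c0) hc.1 (by omega), hmix c0 le_rfl] at hD
    omega

lemma exists_chain {i c0 : ℕ} (h0 : Leftmost T i c0) :
    ∃ d, Chain T i c0 d ∧ ∀ e, e + 1 = d → ¬ Link T i e := by
  classical
  have hex : ∃ d, Chain T i c0 d := ⟨c0, le_rfl, by intros; omega⟩
  refine ⟨Nat.find hex, Nat.find_spec hex, ?_⟩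
  have hs := Nat.find_spec hex
  intro e he hl
  apply Nat.find_min hex (m := e) (by omega)
  have hh : Has T (i + 1) e := by obtain ⟨r, h, _⟩ := hl; exact ⟨r, h⟩
  have hlow := chain_no_pure h0 hs he hh
  refine ⟨by have := hs.1; omega, ?_⟩
  intro c hc1 hc2
  by_cases hce : c = e
  · subst hce; exact ⟨hlow, hh, hl⟩
  · exact hs.2 c (by omega) hc2

lemma main_some (hT : RP T M N) {L : List (ℕ × ℕ)} (hL : IsRL T L) {i : ℕ} (hi : i ≠ 0)
    {d c0 b : ℕ} (h0 : Leftmost T i c0) (hc : Chain T i c0 d)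
    (hnl : ∀ e, e + 1 = d → ¬ Link T i e)
    (hb : IsLow T (i + 1) b d) {A B : List (ℕ × ℕ)} (hdec : L = A ++ (b, d) :: B) :
    Eop i (L.map (fun z => T z.1 z.2)) = some (A.map (fun z => T z.1 z.2) ++ i ::
      B.map (fun z => T z.1 z.2)) := by
  have hi1 : i + 1 ≠ 0 := by omega
  refine Eop_some_of i L _ A B (b, d) hdec hb.1 ?_ ?_
  · exact main_good hT hL hi hc.1 hc.2 h0.high hnl h0.pos hb hdec
  · rintro A1 ⟨s, x⟩ A2 hA hx
    simp only at hx
    have hdec' : L = A1 ++ (s, x) :: (A2 ++ (b, d) :: B) := by rw [hdec, hA]; simp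
    have hsL : (s, x) ∈ L := by rw [hdec']; simp
    have hlow : IsLow T (i + 1) s x := (hL.low hi1 (z := (s, x))).mp ⟨hsL, hx⟩
    have hbef : Bef (s, x) (b, d) := by
      have := hL.sorted
      rw [hdec', List.pairwise_append, List.pairwise_cons] at this
      exact this.2.1.1 _ (by simp)
    have hxd : x < d := by
      by_contra hcon
      have := F1 hT hi1 hb hlow (by omega)
      unfold Bef at hbef
      simp only at hbef
      omega
    obtain ⟨y, h1, h2, h3, h4⟩ := exists_match hT hi (d := d) (by
      intro x hxd hxh hxl
      have hcd := hc.1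
      obtain ⟨y, g1, g2, g3, g4, g5⟩ := first_close hxh hxl (h0.left x (by omega) hxh hxl)
      refine ⟨y, g1, ?_, g2, g3, g4⟩
      by_contra hyd
      by_cases hyc : y < c0
      · exact g3 (hc.2 y (by omega) hyc).2.1
      · have k1 := g5 c0 (by omega) (by omega)
        have k2 := h0.pos (y + 1) (by omega)
        rw [Dl_add (y := c0) (by omega) (by omega)] at g4
        omega) (by
      intro x hxd hl
      by_contra hcon
      exact hnl x (by omega) hl) (d - x) x (by omega) ⟨s, hx⟩ hxd
    exact main_not_good hT hL hi hlow h1 h2 h3 h4 hdec'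

lemma main_none (hT : RP T M N) {L : List (ℕ × ℕ)} (hL : IsRL T L) {i : ℕ} (hi : i ≠ 0)
    (h : ∀ x, Has T (i + 1) x → ¬ Has T i x → ∃ y, x < y ∧ Dl T i x y ≤ 0) :
    unmatchedOpens i (L.map (fun z => T z.1 z.2)) = [] := by
  have hi1 : i + 1 ≠ 0 := by omega
  apply no_unm_of
  rintro A ⟨s, x⟩ B hdec hx
  simp only at hx
  have hsL : (s, x) ∈ L := by rw [hdec]; simp
  have hlow : IsLow T (i + 1) s x := (hL.low hi1 (z := (s, x))).mp ⟨hsL, hx⟩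
  have hxN : x < N := (hT.bdd (r := s) (c := x) (by omega)).2
  obtain ⟨y, h1, h2, h3, h4⟩ := exists_match hT hi (d := N) (by
    intro x hxd hxh hxl
    obtain ⟨y, g1, g2, g3, g4, g5⟩ := first_close hxh hxl (h x hxh hxl)
    refine ⟨y, g1, ?_, g2, g3, g4⟩
    obtain ⟨r, hr⟩ := g2
    exact (hT.bdd (r := r) (c := y) (by omega)).2) (by
    rintro x hxd ⟨r, _, hr⟩
    exact (hT.bdd (r := r) (c := x + 1) (by omega)).2) (N - x) x (by omega) ⟨s, hx⟩ hxN
  exact main_not_good hT hL hi hlow h1 h2 h3 h4 hdec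

end chain
/-! ### Proof: the intermediate tableaux of the descent-resolution algorithm -/
section state
variable {T : ℕ → ℕ → ℕ} {M N : ℕ}

/-- The tableau after the chain has reached column `d`. -/
def st (T : ℕ → ℕ → ℕ) (l : ℕ → ℕ) (i c0 d : ℕ) : ℕ → ℕ → ℕ := fun r c =>
  if T r c = i ∨ T r c = i + 1 then
    if c = d then i
    else if d < c ∧ c ≤ c0 then (if r ≤ l (c - 1) then i else i + 1)
    else T r c
  else T r c

lemma st_band (l : ℕ → ℕ) (i c0 d r c : ℕ) :
    (st T l i c0 d r c = i ∨ st T l i c0 d r c = i + 1) ↔ (T r c = i ∨ T r c = i + 1) := by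
  unfold st
  split_ifs <;> simp_all

lemma st_out (l : ℕ → ℕ) {i c0 d r c : ℕ} (h : c < d ∨ c0 < c) (hd : d ≤ c0) :
    st T l i c0 d r c = T r c := by
  unfold st
  split_ifs <;> first | rfl | omega

lemma st_nband (l : ℕ → ℕ) {i c0 d r c : ℕ} (h : ¬ (T r c = i ∨ T r c = i + 1)) :
    st T l i c0 d r c = T r c := by
  unfold st
  rw [if_neg h]

lemma st_d (l : ℕ → ℕ) {i c0 d r : ℕ} (h : (T r d = i ∨ T r d = i + 1)) :
    st T l i c0 d r d = i := by
  unfold st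
  rw [if_pos h, if_pos rfl]

lemma st_mid (l : ℕ → ℕ) {i c0 d r c : ℕ} (h : (T r c = i ∨ T r c = i + 1)) (h1 : d < c)
    (h2 : c ≤ c0) : st T l i c0 d r c = if r ≤ l (c - 1) then i else i + 1 := by
  unfold st
  rw [if_pos h, if_neg (by omega), if_pos ⟨h1, h2⟩]

lemma bandlow (hT : RP T M N) {i r c : ℕ} (hi : i ≠ 0) (hc : Has T (i + 1) c) :
    ((T r c = i ∨ T r c = i + 1) ∧ ¬ (T (r + 1) c = i ∨ T (r + 1) c = i + 1)) ↔
      IsLow T (i + 1) r c := by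
  constructor
  · rintro ⟨h1, h2⟩
    refine ⟨?_, by omega⟩
    rcases h1 with h1 | h1
    · exfalso
      obtain ⟨s, hs⟩ := hc
      have n1 : T r c ≠ 0 := by omega
      have n2 : T s c ≠ 0 := by omega
      have hrs : r < s := by
        by_contra hcon
        have := hT.mono (by omega : s ≤ r) le_rfl n2 n1
        omega
      have n3 := hT.conv n1 n2 (by omega : r ≤ r + 1) hrs le_rfl le_rfl
      have l1 := hT.mono (by omega : r ≤ r + 1) le_rfl n1 n3
      have l2 := hT.mono (by omega : r + 1 ≤ s) le_rfl n3 n2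
      omega
    · exact h1
  · rintro ⟨h1, h2⟩
    refine ⟨Or.inr h1, ?_⟩
    rintro (h | h)
    · have := hT.mono (by omega : r ≤ r + 1) (le_refl c) (by omega) (by omega)
      omega
    · exact h2 h

lemma st_low_other (l : ℕ → ℕ) {i c0 d v r c : ℕ} (h1 : v ≠ i) (h2 : v ≠ i + 1) :
    IsLow (st T l i c0 d) v r c ↔ IsLow T v r c := by
  have key : ∀ r, st T l i c0 d r c = v ↔ T r c = v := by
    intro r
    by_cases hb : T r c = i ∨ T r c = i + 1
    · have := (st_band l i c0 d r c).mpr hb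
      omega
    · rw [st_nband l hb]
  unfold IsLow
  rw [key, Ne, key]

lemma link_facts (hT : RP T M N) {l : ℕ → ℕ} {i c : ℕ} (hi : i ≠ 0)
    (hl : ∀ r c, IsLow T i r c → l c = r) (h1 : Has T i c) (h2 : Link T i c) :
    IsLow T i (l c) c ∧ (T (l c) (c + 1) = i ∨ T (l c) (c + 1) = i + 1) ∧
    ∃ s, l c < s ∧ T s (c + 1) = i + 1 := by
  obtain ⟨r, hr⟩ := h1
  obtain ⟨r', _, hlow⟩ := exists_low hT hi hr
  have := hl _ _ hlow
  subst this
  obtain ⟨s, hs1, hs2⟩ := h2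
  have l1 := F2 hT hi hs1 hlow.1 le_rfl
  refine ⟨hlow, ?_, s, by omega, hs2⟩
  have e := hlow.1
  have n1 : T (l c) c ≠ 0 := by omega
  have n2 : T s (c + 1) ≠ 0 := by omega
  have n3 : T (l c) (c + 1) ≠ 0 := hT.conv n1 n2 le_rfl (by omega) (by omega) le_rfl
  have k1 := hT.mono le_rfl (by omega : c ≤ c + 1) n1 n3
  have k2 := hT.mono (by omega : l c ≤ s) le_rfl n3 n2
  omega

lemma st_low_high (hT : RP T M N) {l : ℕ → ℕ} {i c0 d r c : ℕ} (hi : i ≠ 0)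
    (hl : ∀ r c, IsLow T i r c → l c = r) (h0 : Leftmost T i c0) (hc : Chain T i c0 d) :
    IsLow (st T l i c0 d) (i + 1) r c ↔ (IsLow T (i + 1) r c ∧ c ≠ d) := by
  have hcd := hc.1
  by_cases hout : c < d ∨ c0 < c
  · unfold IsLow
    rw [st_out l hout hcd, st_out l hout hcd]
    constructor
    · intro h; exact ⟨h, by omega⟩
    · intro h; exact h.1
  by_cases hd : c = d
  · subst hd
    simp only [ne_eq, not_true_eq_false, and_false, iff_false]
    rintro ⟨h1, _⟩
    have hb := (st_band l i c0 c r c).mp (Or.inr h1)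
    rw [st_d l hb] at h1
    omega
  obtain ⟨e, rfl⟩ : ∃ e, c = e + 1 := ⟨c - 1, by omega⟩
  obtain ⟨g1, g2, g3⟩ := hc.2 e (by omega) (by omega)
  obtain ⟨k1, k2, s, k3, k4⟩ := link_facts hT hi hl g1 g3
  have hH : Has T (i + 1) (e + 1) := ⟨s, k4⟩
  have hval : ∀ r, st T l i c0 d r (e + 1) = i + 1 ↔
      (T r (e + 1) = i ∨ T r (e + 1) = i + 1) ∧ l e < r := by
    intro r
    by_cases hb : T r (e + 1) = i ∨ T r (e + 1) = i + 1
    · rw [st_mid l hb (by omega) (by omega), Nat.add_sub_cancel]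
      split_ifs <;> simp [hb] <;> omega
    · rw [st_nband l hb]; constructor
      · intro h; exact absurd (Or.inr h) hb
      · intro h; exact absurd h.1 hb
  have : IsLow (st T l i c0 d) (i + 1) r (e + 1) ↔ IsLow T (i + 1) r (e + 1) := by
    unfold IsLow
    rw [hval, Ne, hval]
    change _ ↔ IsLow T (i + 1) r (e + 1)
    constructor
    · rintro ⟨⟨h1, h2⟩, h3⟩
      rw [← bandlow hT hi hH]
      exact ⟨h1, fun h => h3 ⟨h, by omega⟩⟩
    · intro h
      have h' := (bandlow hT hi hH).mpr h
      have := low_le hT (by omega) h k4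
      exact ⟨⟨h'.1, by omega⟩, fun h3 => h'.2 h3.1⟩
  rw [this]
  simp [hd]

lemma st_low_low (hT : RP T M N) {l : ℕ → ℕ} {i c0 d b r c : ℕ} (hi : i ≠ 0)
    (hl : ∀ r c, IsLow T i r c → l c = r) (hc : Chain T i c0 d)
    (hb : IsLow T (i + 1) b d) :
    IsLow (st T l i c0 d) i r c ↔ ((c < d ∨ c0 < c) ∧ IsLow T i r c) ∨ (c = d ∧ r = b) ∨
      ∃ e, d ≤ e ∧ e < c0 ∧ c = e + 1 ∧ IsLow T i r e := by
  have hcd := hc.1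
  by_cases hout : c < d ∨ c0 < c
  · have : IsLow (st T l i c0 d) i r c ↔ IsLow T i r c := by
      unfold IsLow
      rw [st_out l hout hcd, st_out l hout hcd]
    rw [this]
    constructor
    · intro h; exact Or.inl ⟨hout, h⟩
    · rintro (h | h | ⟨e, h⟩)
      · exact h.2
      · omega
      · omega
  by_cases hd : c = d
  · subst hd
    have hval : ∀ r, st T l i c0 c r c = i ↔ (T r c = i ∨ T r c = i + 1) := by
      intro r
      constructor
      · intro h; exact (st_band l i c0 c r c).mp (Or.inl h)
      · intro h; exact st_d l h
    have : IsLow (st T l i c0 c) i r c ↔ IsLow T (i + 1) r c := by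
      rw [← bandlow hT hi ⟨b, hb.1⟩]
      unfold IsLow
      rw [hval, Ne, hval]
    rw [this]
    constructor
    · intro h
      exact Or.inr (Or.inl ⟨rfl, low_unique hT (by omega) h hb⟩)
    · rintro (h | h | ⟨e, h⟩)
      · omega
      · rw [h.2]; exact hb
      · omega
  obtain ⟨e, rfl⟩ : ∃ e, c = e + 1 := ⟨c - 1, by omega⟩
  obtain ⟨g1, g2, g3⟩ := hc.2 e (by omega) (by omega)
  obtain ⟨k1, k2, s, k3, k4⟩ := link_facts hT hi hl g1 g3
  have hval : ∀ r, st T l i c0 d r (e + 1) = i ↔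
      (T r (e + 1) = i ∨ T r (e + 1) = i + 1) ∧ r ≤ l e := by
    intro r
    by_cases hb : T r (e + 1) = i ∨ T r (e + 1) = i + 1
    · rw [st_mid l hb (by omega) (by omega), Nat.add_sub_cancel]
      split_ifs <;> simp [hb] <;> omega
    · rw [st_nband l hb]; constructor
      · intro h; exact absurd (Or.inl h) hb
      · intro h; exact absurd h.1 hb
  have : IsLow (st T l i c0 d) i r (e + 1) ↔ IsLow T i r e := by
    unfold IsLow
    rw [hval, Ne, hval]
    change _ ↔ IsLow T i r e
    constructor
    · rintro ⟨⟨h1, h2⟩, h3⟩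
      have : r = l e := by
        by_contra hne
        apply h3
        refine ⟨?_, by omega⟩
        have n1 : T r (e + 1) ≠ 0 := by omega
        have n2 : T (l e) (e + 1) ≠ 0 := by omega
        have n3 : T (r + 1) (e + 1) ≠ 0 :=
          hT.conv n1 n2 (by omega) (by omega) le_rfl le_rfl
        have k1 := hT.mono (by omega : r ≤ r + 1) le_rfl n1 n3
        have k2 := hT.mono (by omega : r + 1 ≤ l e) le_rfl n3 n2
        omega
      rw [this]; exact k1
    · intro h
      have := hl _ _ h
      subst this
      exact ⟨⟨k2, le_rfl⟩, fun h => by omega⟩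
  rw [this]
  constructor
  · intro h
    exact Or.inr (Or.inr ⟨e, by omega, by omega, rfl, h⟩)
  · rintro (h | h | ⟨e', h1, h2, h3, h4⟩)
    · exact h.2.elim (fun _ => by omega)
    · omega
    · obtain rfl : e = e' := by omega
      exact h4

/-- `R` is the list of columns read in row `r`. -/
structure IsRow (T : ℕ → ℕ → ℕ) (r : ℕ) (R : List ℕ) : Prop where
  sorted : R.Pairwise (· < ·)
  mem : ∀ c, c ∈ R ↔ T r c ≠ 0 ∧ T (r + 1) c ≠ T r c

open Classical in
lemma row_count {R : List ℕ} {r : ℕ} (h : IsRow T r R) {v : ℕ} (hv : v ≠ 0)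
    (hN : ∀ c, T r c ≠ 0 → c < N) :
    (R.map (T r)).count v = ((Finset.range N).filter (fun c => IsLow T v r c)).card := by
  apply le_antisymm
  · refine count_le _ _ _ (h.sorted.imp (fun h => Nat.ne_of_lt h)) id _ ?_ (by simp)
    intro c hc hf
    have := (h.mem c).mp hc
    simp only [Finset.mem_filter, Finset.mem_range, id]
    exact ⟨hN c this.1, hf, by rw [← hf]; exact this.2⟩
  · refine le_count _ _ _ id _ ?_ (by simp)
    intro c hc
    simp only [Finset.mem_filter, Finset.mem_range] at hc
    refine ⟨(h.mem c).mpr ⟨?_, ?_⟩, hc.2.1⟩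
    · show T r c ≠ 0; rw [hc.2.1]; exact hv
    · show T (r + 1) c ≠ T r c; rw [hc.2.1]; exact hc.2.2

open Classical in
lemma card_low (hT : RP T M N) {l : ℕ → ℕ} {i c0 d b r : ℕ} (hi : i ≠ 0)
    (hl : ∀ r c, IsLow T i r c → l c = r) (h0 : Leftmost T i c0) (hc : Chain T i c0 d)
    (hb : IsLow T (i + 1) b d) :
    ((Finset.range N).filter (fun c => IsLow (st T l i c0 d) i r c)).card =
    ((Finset.range N).filter (fun c => IsLow T i r c)).card + (if r = b then 1 else 0) := by
  have hc0N : c0 < N := by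
    obtain ⟨s, hs⟩ := h0.high
    exact (hT.bdd (r := s) (c := c0) (by omega)).2
  have hcd := hc.1
  have hne : ∀ r, ¬ IsLow T i r c0 := fun r h => h0.nlow ⟨r, h.1⟩
  set S := (Finset.range N).filter (fun c => IsLow T i r c) with hS
  let e : ℕ → ℕ := fun c => if d ≤ c ∧ c < c0 then c + 1 else c
  have hcard : (S.image e).card = S.card := by
    apply Finset.card_image_of_injOn
    intro a ha a' ha' hh
    simp only [hS, Finset.coe_filter, Finset.mem_range, Set.mem_setOf_eq] at ha ha'
    have h1 : a ≠ c0 := by rintro rfl; exact hne _ ha.2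
    have h2 : a' ≠ c0 := by rintro rfl; exact hne _ ha'.2
    simp only [e] at hh
    split_ifs at hh <;> omega
  have hset : (Finset.range N).filter (fun c => IsLow (st T l i c0 d) i r c) =
      S.image e ∪ (if r = b then {d} else ∅) := by
    ext c
    simp only [Finset.mem_filter, Finset.mem_range, Finset.mem_union, Finset.mem_image,
      st_low_low hT hi hl hc hb, hS]
    constructor
    · rintro ⟨hcN, ⟨h1, h2⟩ | ⟨h1, h2⟩ | ⟨x, h1, h2, h3, h4⟩⟩
      · left
        refine ⟨c, ⟨hcN, h2⟩, ?_⟩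
        simp only [e]; rw [if_neg (by omega)]
      · right
        simp [h1, h2]
      · left
        refine ⟨x, ⟨by omega, h4⟩, ?_⟩
        simp only [e]; rw [if_pos (by omega)]; exact h3.symm
    · rintro (⟨x, ⟨h1, h2⟩, h3⟩ | h)
      · have hx : x ≠ c0 := by rintro rfl; exact hne _ h2
        simp only [e] at h3
        split_ifs at h3 with hh
        · exact ⟨by omega, Or.inr (Or.inr ⟨x, hh.1, hh.2, h3.symm, h2⟩)⟩
        · subst h3
          exact ⟨h1, Or.inl ⟨by omega, h2⟩⟩
      · split_ifs at h with hr
        · simp at h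
          subst h
          exact ⟨by omega, Or.inr (Or.inl ⟨rfl, hr⟩)⟩
        · simp at h
  rw [hset, Finset.card_union_of_disjoint, hcard]
  · split_ifs <;> simp
  · rw [Finset.disjoint_left]
    intro a ha ha'
    split_ifs at ha' with hr
    · simp only [Finset.mem_singleton] at ha'
      simp only [Finset.mem_image, hS, Finset.mem_filter] at ha
      obtain ⟨x, ⟨h1, h2⟩, h3⟩ := ha
      have hx : x ≠ c0 := by rintro rfl; exact hne _ h2
      simp only [e] at h3
      split_ifs at h3 <;> omega
    · simp at ha'

open Classical in
lemma card_high (hT : RP T M N) {l : ℕ → ℕ} {i c0 d b r : ℕ} (hi : i ≠ 0)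
    (hl : ∀ r c, IsLow T i r c → l c = r) (h0 : Leftmost T i c0) (hc : Chain T i c0 d)
    (hb : IsLow T (i + 1) b d) :
    ((Finset.range N).filter (fun c => IsLow (st T l i c0 d) (i + 1) r c)).card +
      (if r = b then 1 else 0) =
    ((Finset.range N).filter (fun c => IsLow T (i + 1) r c)).card := by
  have hdN : d < N := (hT.bdd (r := b) (c := d) (by have := hb.1; omega)).2
  simp only [st_low_high hT hi hl h0 hc]
  split_ifs with hr
  · subst hr
    have : (Finset.range N).filter (fun c => IsLow T (i + 1) r c) =
        insert d ((Finset.range N).filter (fun c => IsLow T (i + 1) r c ∧ c ≠ d)) := by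
      ext c
      simp only [Finset.mem_filter, Finset.mem_range, Finset.mem_insert]
      constructor
      · rintro ⟨h1, h2⟩
        by_cases h : c = d
        · exact Or.inl h
        · exact Or.inr ⟨h1, h2, h⟩
      · rintro (rfl | h)
        · exact ⟨hdN, hb⟩
        · exact ⟨h.1, h.2.1⟩
    rw [this, Finset.card_insert_of_notMem (by simp)]
  · rw [add_zero]
    congr 1
    ext c
    simp only [Finset.mem_filter, Finset.mem_range, and_congr_right_iff, and_iff_left_iff_imp]
    rintro _ h rfl
    exact hr (low_unique hT (by omega) h hb)

lemma st_sorted (hT : RP T M N) {l : ℕ → ℕ} {i c0 d r : ℕ} (hi : i ≠ 0)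
    (hnd : ∀ r c, ¬ (st T l i c0 d r c = i + 1 ∧ st T l i c0 d r (c + 1) = i))
    {R : List ℕ} (hR : IsRow (st T l i c0 d) r R) :
    (R.map (st T l i c0 d r)).Pairwise (· ≤ ·) := by
  have hz : ∀ c, st T l i c0 d r c ≠ 0 ↔ T r c ≠ 0 := by
    intro c
    by_cases hb : T r c = i ∨ T r c = i + 1
    · have := (st_band l i c0 d r c).mpr hb; omega
    · rw [st_nband l hb]
  have hadj : ∀ c, T r c ≠ 0 → T r (c + 1) ≠ 0 →
      st T l i c0 d r c ≤ st T l i c0 d r (c + 1) := by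
    intro c h1 h2
    have hm := hT.mono (le_refl r) (by omega : c ≤ c + 1) h1 h2
    have hn := hnd r c
    have b1 := st_band (T := T) l i c0 d r c
    have b2 := st_band (T := T) l i c0 d r (c + 1)
    by_cases hb : T r c = i ∨ T r c = i + 1
    · have b1' := b1.mpr hb
      by_cases hb2 : T r (c + 1) = i ∨ T r (c + 1) = i + 1
      · have b2' := b2.mpr hb2
        omega
      · rw [st_nband l hb2]
        omega
    · rw [st_nband l hb]
      by_cases hb2 : T r (c + 1) = i ∨ T r (c + 1) = i + 1
      · have b2' := b2.mpr hb2
        omega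
      · rw [st_nband l hb2]
        omega
  have hmono : ∀ k c, T r c ≠ 0 → T r (c + k) ≠ 0 →
      st T l i c0 d r c ≤ st T l i c0 d r (c + k) := by
    intro k
    induction k with
    | zero => intros; exact le_rfl
    | succ k ih =>
      intro c h1 h2
      have h3 : T r (c + k) ≠ 0 := hT.conv h1 h2 le_rfl le_rfl (by omega) (by omega)
      exact (ih c h1 h3).trans (hadj (c + k) h3 h2)
  rw [List.pairwise_map]
  refine List.Pairwise.imp_of_mem ?_ hR.sorted
  intro a a' ha ha' hlt
  have h1 := (hz a).mp ((hR.mem a).mp ha).1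
  have h2 := (hz a').mp ((hR.mem a').mp ha').1
  obtain ⟨k, rfl⟩ : ∃ k, a' = a + k := ⟨a' - a, by omega⟩
  exact hmono k a h1 h2

lemma row_sorted (hT : RP T M N) {r : ℕ} {R : List ℕ} (hR : IsRow T r R) :
    (R.map (T r)).Pairwise (· ≤ ·) := by
  rw [List.pairwise_map]
  refine List.Pairwise.imp_of_mem ?_ hR.sorted
  intro a a' ha ha' hlt
  exact hT.mono le_rfl hlt.le ((hR.mem a).mp ha).1 ((hR.mem a').mp ha').1

lemma count_zero_row {r : ℕ} {R : List ℕ} (hR : IsRow T r R) : (R.map (T r)).count 0 = 0 := by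
  rw [List.count_eq_zero]
  intro h
  obtain ⟨c, hc, h0⟩ := List.mem_map.mp h
  exact ((hR.mem c).mp hc).1 h0

lemma row_counts (hT : RP T M N) {l : ℕ → ℕ} {i c0 d b r : ℕ} (hi : i ≠ 0)
    (hl : ∀ r c, IsLow T i r c → l c = r) (h0 : Leftmost T i c0) (hc : Chain T i c0 d)
    (hb : IsLow T (i + 1) b d) {R R' : List ℕ} (hR : IsRow T r R)
    (hR' : IsRow (st T l i c0 d) r R') (v : ℕ) :
    (R'.map (st T l i c0 d r)).count v + (if r = b ∧ v = i + 1 then 1 else 0) =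
      (R.map (T r)).count v + (if r = b ∧ v = i then 1 else 0) := by
  classical
  have hN : ∀ c, T r c ≠ 0 → c < N := fun c h => (hT.bdd h).2
  have hN' : ∀ c, st T l i c0 d r c ≠ 0 → c < N := by
    intro c h
    apply hN
    by_cases hb : T r c = i ∨ T r c = i + 1
    · omega
    · rwa [st_nband l hb] at h
  by_cases hv : v = 0
  · subst hv
    rw [count_zero_row hR, count_zero_row hR', if_neg (by omega), if_neg (by omega)]
  rw [row_count hR hv hN, row_count hR' hv hN']
  by_cases h1 : v = i
  · subst h1
    have := card_low (r := r) hT hi hl h0 hc hb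
    rw [this]
    simp
  by_cases h2 : v = i + 1
  · subst h2
    have := card_high (r := r) hT hi hl h0 hc hb
    rw [← this]
    simp
  · simp only [st_low_other l h1 h2]
    simp [h1, h2]

lemma row_eq (hT : RP T M N) {l : ℕ → ℕ} {i c0 d b r : ℕ} (hi : i ≠ 0)
    (hl : ∀ r c, IsLow T i r c → l c = r) (h0 : Leftmost T i c0) (hc : Chain T i c0 d)
    (hnd : ∀ r c, ¬ (st T l i c0 d r c = i + 1 ∧ st T l i c0 d r (c + 1) = i))
    (hb : IsLow T (i + 1) b d) {R R' : List ℕ} (hR : IsRow T r R)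
    (hR' : IsRow (st T l i c0 d) r R') (hr : r ≠ b) :
    R'.map (st T l i c0 d r) = R.map (T r) := by
  refine List.Perm.eq_of_pairwise (le := (· ≤ ·)) (fun a b _ _ h1 h2 => le_antisymm h1 h2)
    (st_sorted hT hi hnd hR') (row_sorted hT hR) ?_
  rw [List.perm_iff_count]
  intro v
  have := row_counts hT hi hl h0 hc hb hR hR' v
  simpa [hr] using this

lemma row_eq_b (hT : RP T M N) {l : ℕ → ℕ} {i c0 d b : ℕ} (hi : i ≠ 0)
    (hl : ∀ r c, IsLow T i r c → l c = r) (h0 : Leftmost T i c0) (hc : Chain T i c0 d)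
    (hnl : ∀ e, e + 1 = d → ¬ Link T i e)
    (hnd : ∀ r c, ¬ (st T l i c0 d r c = i + 1 ∧ st T l i c0 d r (c + 1) = i))
    (hb : IsLow T (i + 1) b d) {R R' A B : List ℕ} (hR : IsRow T b R)
    (hR' : IsRow (st T l i c0 d) b R') (hdec : R = A ++ d :: B) :
    R'.map (st T l i c0 d b) = A.map (T b) ++ i :: B.map (T b) := by
  have hsd := row_sorted hT hR
  have hRs := hR.sorted
  rw [hdec, List.pairwise_append, List.pairwise_cons] at hRs
  have hA : ∀ c ∈ A, T b c ≤ i := by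
    intro c hcA
    have hlt : c < d := hRs.2.2 c hcA d (by simp)
    have hcn : T b c ≠ 0 := ((hR.mem c).mp (by rw [hdec]; simp [hcA])).1
    have hdn : T b d ≠ 0 := by have := hb.1; omega
    have hm := hT.mono (le_refl b) hlt.le hcn hdn
    have e := hb.1
    by_contra hcon
    refine hnl (d - 1) (by omega) ⟨b, ?_, ?_⟩
    · have hn : T b (d - 1) ≠ 0 := hT.conv hcn hdn le_rfl le_rfl (by omega) (by omega)
      have m1 := hT.mono (le_refl b) (by omega : c ≤ d - 1) hcn hn
      have m2 := hT.mono (le_refl b) (by omega : d - 1 ≤ d) hn hdn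
      omega
    · rw [Nat.sub_add_cancel (by omega)]; exact e
  refine List.Perm.eq_of_pairwise (le := (· ≤ ·)) (fun a b _ _ h1 h2 => le_antisymm h1 h2)
    (st_sorted hT hi hnd hR') ?_ ?_
  · rw [hdec, List.map_append, List.map_cons, List.pairwise_append, List.pairwise_cons] at hsd
    rw [List.pairwise_append, List.pairwise_cons]
    obtain ⟨s1, ⟨s2, s3⟩, s4⟩ := hsd
    have e := hb.1
    refine ⟨s1, ⟨?_, s3⟩, ?_⟩
    · intro x hx
      have := s2 x hx
      omega
    · intro x hx y hy
      obtain ⟨c, hcA, rfl⟩ := List.mem_map.mp hx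
      have := hA c hcA
      rcases List.mem_cons.mp hy with rfl | hy
      · exact this
      · have := s2 y hy
        omega
  · rw [List.perm_iff_count]
    intro v
    have := row_counts hT hi hl h0 hc hb hR hR' v
    rw [hdec] at this
    simp only [List.map_append, List.map_cons, List.count_append, List.count_cons, hb.1] at this ⊢
    simp only [true_and, beq_iff_eq] at this ⊢
    by_cases h1 : v = i
    · subst h1; simp at this ⊢; omega
    · by_cases h2 : v = i + 1
      · subst h2; simp at this ⊢; omega
      · have h3 : ¬ i = v := fun h => h1 h.symm
        have h4 : ¬ i + 1 = v := fun h => h2 h.symm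
        simp [h1, h2, h3, h4] at this ⊢; omega

end state
/-! ### Proof: glue with the shape -/
section glue
variable {lam mu : YoungDiagram} {T : ℕ → ℕ → ℕ} {m : ℕ}

/-- the support of `T` is the shape -/
def Supp (lam mu : YoungDiagram) (T : ℕ → ℕ → ℕ) : Prop :=
  ∀ r c, IsSkewCell lam mu r c ↔ T r c ≠ 0

lemma supp_of (hT : IsSkewRPP lam mu m T) : Supp lam mu T := by
  intro r c
  constructor
  · intro h
    have := (hT.2.1 r c h).1
    omega
  · intro h
    by_contra hc
    exact h (hT.1 r c hc)

lemma cell_conv {r c r' c' s t : ℕ} (h1 : IsSkewCell lam mu r c) (h2 : IsSkewCell lam mu r' c')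
    (a1 : r ≤ s) (a2 : s ≤ r') (a3 : c ≤ t) (a4 : t ≤ c') : IsSkewCell lam mu s t := by
  refine ⟨?_, ?_⟩
  · exact lam.up_left_mem a2 a4 h2.1
  · intro h
    exact h1.2 (mu.up_left_mem a1 a3 h)

lemma cell_lt {r c : ℕ} (h : IsSkewCell lam mu r c) : r < lam.colLen c ∧ c < lam.rowLen r ∧
    r < lam.colLen 0 ∧ c < lam.rowLen 0 := by
  have h1 : (r, c) ∈ lam := h.1
  refine ⟨YoungDiagram.mem_iff_lt_colLen.mp h1, YoungDiagram.mem_iff_lt_rowLen.mp h1,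
    YoungDiagram.mem_iff_lt_colLen.mp (lam.up_left_mem le_rfl (Nat.zero_le _) h1),
    YoungDiagram.mem_iff_lt_rowLen.mp (lam.up_left_mem (Nat.zero_le _) le_rfl h1)⟩

lemma rp_of (hT : IsSkewRPP lam mu m T) : RP T (lam.colLen 0) (lam.rowLen 0) := by
  have hs := supp_of hT
  have hconv : ∀ {r c r' c' s t : ℕ}, T r c ≠ 0 → T r' c' ≠ 0 → r ≤ s → s ≤ r' → c ≤ t →
      t ≤ c' → T s t ≠ 0 := by
    intro r c r' c' s t h1 h2 a1 a2 a3 a4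
    rw [← hs] at h1 h2 ⊢
    exact cell_conv h1 h2 a1 a2 a3 a4
  have hrow : ∀ k r c, T r c ≠ 0 → T r (c + k) ≠ 0 → T r c ≤ T r (c + k) := by
    intro k
    induction k with
    | zero => intros; exact le_rfl
    | succ k ih =>
      intro r c h1 h2
      have h3 : T r (c + k) ≠ 0 := hconv h1 h2 le_rfl le_rfl (by omega) (by omega)
      exact (ih r c h1 h3).trans (hT.2.2.1 r (c + k) ((hs _ _).mpr h3) ((hs _ _).mpr h2))
  have hcol : ∀ k r c, T r c ≠ 0 → T (r + k) c ≠ 0 → T r c ≤ T (r + k) c := by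
    intro k
    induction k with
    | zero => intros; exact le_rfl
    | succ k ih =>
      intro r c h1 h2
      have h3 : T (r + k) c ≠ 0 := hconv h1 h2 (by omega) (by omega) le_rfl le_rfl
      exact (ih r c h1 h3).trans (hT.2.2.2 (r + k) c ((hs _ _).mpr h3) ((hs _ _).mpr h2))
  refine ⟨hconv, ?_, ?_⟩
  · intro r c s t h1 h2 a1 a2
    obtain ⟨k, rfl⟩ : ∃ k, s = r + k := ⟨s - r, by omega⟩
    obtain ⟨k', rfl⟩ : ∃ k, t = c + k := ⟨t - c, by omega⟩
    have h3 : T r (c + k') ≠ 0 := hconv a1 a2 le_rfl h1 h2 le_rfl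
    exact (hrow k' r c a1 h3).trans (hcol k r (c + k') h3 a2)
  · intro r c h
    have := cell_lt ((hs r c).mpr h)
    exact ⟨this.2.2.1, this.2.2.2⟩

lemma colHas_iff (hs : Supp lam mu T) {c v : ℕ} (hv : v ≠ 0) :
    ColHasVal lam mu T c v ↔ Has T v c := by
  constructor
  · rintro ⟨r, _, _, h⟩; exact ⟨r, h⟩
  · rintro ⟨r, h⟩
    have hc : IsSkewCell lam mu r c := (hs r c).mpr (by omega)
    exact ⟨r, Finset.mem_range.mpr (cell_lt hc).1, hc, h⟩

lemma lowestLow_eq (hT : RP T (lam.colLen 0) (lam.rowLen 0)) (hs : Supp lam mu T) {i r c : ℕ}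
    (hi : i ≠ 0) (h : IsLow T i r c) : lowestLow i lam mu T c = r := by
  unfold lowestLow
  apply le_antisymm
  · apply csSup_le
    · exact ⟨r, (hs r c).mpr (by have := h.1; omega), h.1⟩
    · rintro s ⟨_, hs'⟩
      exact low_le hT hi h hs'
  · apply le_csSup
    · refine ⟨r, ?_⟩
      rintro s ⟨_, hs'⟩
      exact low_le hT hi h hs'
    · exact ⟨(hs r c).mpr (by have := h.1; omega), h.1⟩

lemma isPL_of (hs : Supp lam mu T) {i : ℕ} (hi : i ≠ 0) : IsPL T i (pureCols i lam mu T) := by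
  refine ⟨List.Pairwise.filter _ List.pairwise_lt_range, ?_⟩
  intro c
  unfold pureCols
  simp only [List.mem_filter, List.mem_range, Bool.or_eq_true, decide_eq_true_eq]
  unfold IsPureLow IsPureHigh
  rw [colHas_iff hs hi, colHas_iff hs (Nat.succ_ne_zero i)]
  constructor
  · rintro ⟨_, h⟩; exact h
  · intro h
    refine ⟨?_, h⟩
    rcases h with ⟨⟨r, h⟩, _⟩ | ⟨⟨r, h⟩, _⟩
    · exact (cell_lt ((hs r c).mpr (by omega))).2.2.2
    · exact (cell_lt ((hs r c).mpr (by omega))).2.2.2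

lemma lab1 (hs : Supp lam mu T) {i : ℕ} (hi : i ≠ 0) : ∀ c ∈ pureCols i lam mu T, Has T i c →
    (fun c => if IsPureLow i lam mu T c then i else i + 1) c = i := by
  intro c hc h
  have := ((isPL_of hs hi).mem c).mp hc
  simp only
  rw [if_pos]
  unfold IsPureLow
  rw [colHas_iff hs hi, colHas_iff hs (Nat.succ_ne_zero i)]
  tauto

lemma lab2 (hs : Supp lam mu T) {i : ℕ} (hi : i ≠ 0) : ∀ c ∈ pureCols i lam mu T, ¬ Has T i c →
    (fun c => if IsPureLow i lam mu T c then i else i + 1) c = i + 1 := by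
  intro c hc h
  simp only
  rw [if_neg]
  unfold IsPureLow
  rw [colHas_iff hs hi]
  tauto

/-- columns read in row `r` -/
def rowC (lam mu : YoungDiagram) (T : ℕ → ℕ → ℕ) (r : ℕ) : List ℕ :=
  (List.range (lam.rowLen r)).filter fun c =>
      decide (IsSkewCell lam mu r c) &&
        ! (decide (IsSkewCell lam mu (r + 1) c) && decide (T (r + 1) c = T r c))

lemma isRow_of (hs : Supp lam mu T) (r : ℕ) : IsRow T r (rowC lam mu T r) := by
  refine ⟨List.Pairwise.filter _ List.pairwise_lt_range, ?_⟩
  intro c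
  unfold rowC
  simp only [List.mem_filter, List.mem_range, Bool.and_eq_true, decide_eq_true_eq,
    Bool.not_eq_true', Bool.and_eq_false_iff, decide_eq_false_iff_not]
  constructor
  · rintro ⟨h1, h2, h3⟩
    rw [hs] at h2 h3
    refine ⟨h2, ?_⟩
    rcases h3 with h3 | h3
    · omega
    · exact h3
  · rintro ⟨h1, h2⟩
    have hc := (hs r c).mpr h1
    exact ⟨(cell_lt hc).2.1, hc, Or.inr h2⟩

/-- cells of the reading word -/
def RL (lam mu : YoungDiagram) (T : ℕ → ℕ → ℕ) : List (ℕ × ℕ) :=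
  ((List.range (lam.colLen 0)).reverse).flatMap fun r => (rowC lam mu T r).map fun c => (r, c)

lemma readingWord_eq' : readingWord lam mu T =
    ((List.range (lam.colLen 0)).reverse).flatMap fun r => (rowC lam mu T r).map (T r) := rfl

lemma readingWord_eq : readingWord lam mu T = (RL lam mu T).map fun z => T z.1 z.2 := by
  rw [readingWord_eq', RL, List.map_flatMap]
  simp only [List.map_map]
  rfl

lemma isRL_of (hs : Supp lam mu T) : IsRL T (RL lam mu T) := by
  constructor
  · unfold RL
    rw [List.pairwise_flatMap]
    constructor
    · intro r _
      rw [List.pairwise_map]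
      exact (isRow_of hs r).sorted.imp (fun h => Or.inr ⟨rfl, h⟩)
    · rw [List.pairwise_reverse]
      refine List.pairwise_lt_range.imp ?_
      intro a b hab x hx y hy
      obtain ⟨c, _, rfl⟩ := List.mem_map.mp hx
      obtain ⟨c', _, rfl⟩ := List.mem_map.mp hy
      exact Or.inl hab
  · intro r c
    unfold RL
    simp only [List.mem_flatMap, List.mem_reverse, List.mem_range, List.mem_map, Prod.mk.injEq]
    constructor
    · rintro ⟨r', h, c', hc', rfl, rfl⟩
      exact ((isRow_of hs _).mem _).mp hc'
    · intro h
      exact ⟨r, (cell_lt ((hs r c).mpr h.1)).2.2.1, c, ((isRow_of hs _).mem _).mpr h, rfl, rfl⟩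

lemma supp_st (hs : Supp lam mu T) (l : ℕ → ℕ) {i c0 d : ℕ} (hi : i ≠ 0) :
    Supp lam mu (st T l i c0 d) := by
  intro r c
  rw [hs]
  by_cases hb : T r c = i ∨ T r c = i + 1
  · have := (st_band l i c0 d r c).mpr hb
    omega
  · rw [st_nband l hb]

lemma decomp (hT : RP T (lam.colLen 0) (lam.rowLen 0)) (hs : Supp lam mu T) {l : ℕ → ℕ}
    {i c0 d b : ℕ} (hi : i ≠ 0)
    (hl : ∀ r c, IsLow T i r c → l c = r) (h0 : Leftmost T i c0) (hc : Chain T i c0 d)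
    (hnl : ∀ e, e + 1 = d → ¬ Link T i e)
    (hnd : ∀ r c, ¬ (st T l i c0 d r c = i + 1 ∧ st T l i c0 d r (c + 1) = i))
    (hb : IsLow T (i + 1) b d) :
    ∃ A B, RL lam mu T = A ++ (b, d) :: B ∧ readingWord lam mu (st T l i c0 d) =
      A.map (fun z => T z.1 z.2) ++ i :: B.map (fun z => T z.1 z.2) := by
  have hb1 := hb.1
  have hb2 := hb.2
  have hbd : d ∈ rowC lam mu T b := ((isRow_of hs b).mem d).mpr ⟨by omega, by omega⟩
  have hbM : b ∈ (List.range (lam.colLen 0)).reverse := by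
    rw [List.mem_reverse, List.mem_range]
    exact (hT.bdd (r := b) (c := d) (by omega)).1
  obtain ⟨R1, R2, hR⟩ := List.append_of_mem hbM
  obtain ⟨A, B, hAB⟩ := List.append_of_mem hbd
  have hnd2 : (R1 ++ b :: R2).Nodup := by
    rw [← hR]; exact List.nodup_reverse.mpr List.nodup_range
  have hn1 : ∀ r ∈ R1, r ≠ b := by
    rintro r hr rfl
    rw [List.nodup_append] at hnd2
    exact hnd2.2.2 r hr r (by simp) rfl
  have hn2 : ∀ r ∈ R2, r ≠ b := by
    rintro r hr rfl
    rw [List.nodup_append, List.nodup_cons] at hnd2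
    exact hnd2.2.1.1 hr
  have hs' := supp_st (c0 := c0) (d := d) hs l hi
  have hrow : ∀ r, r ≠ b → (rowC lam mu (st T l i c0 d) r).map (st T l i c0 d r) =
      (rowC lam mu T r).map (T r) := fun r hr =>
    row_eq hT hi hl h0 hc hnd hb (isRow_of hs r) (isRow_of hs' r) hr
  have hrb := row_eq_b hT hi hl h0 hc hnl hnd hb (isRow_of hs b) (isRow_of hs' b) hAB
  refine ⟨R1.flatMap (fun r => (rowC lam mu T r).map fun c => (r, c)) ++ A.map (fun c => (b, c)),
    B.map (fun c => (b, c)) ++ R2.flatMap (fun r => (rowC lam mu T r).map fun c => (r, c)), ?_, ?_⟩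
  · unfold RL
    rw [hR, List.flatMap_append, List.flatMap_cons, hAB]
    simp
  · rw [readingWord_eq', hR, List.flatMap_append, List.flatMap_cons, hrb]
    have e1 : ∀ R : List ℕ, (∀ r ∈ R, r ≠ b) →
        R.flatMap (fun r => (rowC lam mu (st T l i c0 d) r).map (st T l i c0 d r)) =
        (R.flatMap (fun r => (rowC lam mu T r).map fun c => (r, c))).map
          (fun z => T z.1 z.2) := by
      intro R hR
      rw [List.map_flatMap]
      apply List.flatMap_congr
      intro r hr
      rw [hrow r (hR r hr), List.map_map]
      rfl
    rw [e1 R1 hn1, e1 R2 hn2]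
    simp only [List.map_append, List.map_map, List.append_assoc, List.cons_append]
    rfl

lemma lowerCol_eq (hs : Supp lam mu T) (l : ℕ → ℕ) {i c0 : ℕ} (hl : ¬ Has T i c0) :
    lowerCol i lam mu T c0 = st T l i c0 c0 := by
  funext r c
  unfold lowerCol st
  simp only [hs r c]
  by_cases h : c = c0
  · subst h
    have : T r c ≠ i := fun h => hl ⟨r, h⟩
    by_cases h2 : T r c = i + 1
    · simp [h2]
    · simp [this, h2]
  · have : ¬ (c0 < c ∧ c ≤ c0) := by omega
    simp [h, this]

lemma step_lemma (hT : RP T (lam.colLen 0) (lam.rowLen 0)) (hs : Supp lam mu T)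
    {i c0 d r c : ℕ} (hi : i ≠ 0) {l : ℕ → ℕ}
    (hl : ∀ r c, IsLow T i r c → l c = r) (h0 : Leftmost T i c0) (hc : Chain T i c0 d)
    (h1 : st T l i c0 d r c = i + 1) (h2 : st T l i c0 d r (c + 1) = i) :
    c + 1 = d ∧ Link T i c := by
  have hcd := hc.1
  have b1 := (st_band l i c0 d r c).mp (Or.inr h1)
  have b2 := (st_band l i c0 d r (c + 1)).mp (Or.inl h2)
  have hm := hT.mono (le_refl r) (by omega : c ≤ c + 1) (by omega) (by omega)
  rcases lt_trichotomy (c + 1) d with h | h | h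
  · rw [st_out l (Or.inl (by omega)) hcd] at h1 h2
    omega
  · rw [st_out l (Or.inl (by omega)) hcd] at h1
    exact ⟨h, r, h1, by omega⟩
  · exfalso
    by_cases hcd' : c = d
    · subst hcd'
      rw [st_d l b1] at h1; omega
    by_cases hc0 : c0 < c
    · rw [st_out l (Or.inr (by omega)) hcd] at h1 h2
      omega
    obtain ⟨e, rfl⟩ : ∃ e, c = e + 1 := ⟨c - 1, by omega⟩
    obtain ⟨g1, g2, g3⟩ := hc.2 e (by omega) (by omega)
    obtain ⟨k1, k2, s, k3, k4⟩ := link_facts hT hi hl g1 g3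
    rw [st_mid l b1 (by omega) (by omega), Nat.add_sub_cancel] at h1
    have hr : l e < r := by
      by_contra hcon
      rw [if_pos (by omega)] at h1; omega
    by_cases hc0' : e + 1 = c0
    · rw [st_out l (Or.inr (by omega)) hcd] at h2
      have : T r (e + 1) = i := by omega
      exact h0.nlow (hc0' ▸ ⟨r, this⟩)
    · rw [st_mid l b2 (by omega) (by omega), Nat.add_sub_cancel] at h2
      obtain ⟨g1', g2', g3'⟩ := hc.2 (e + 1) (by omega) (by omega)
      obtain ⟨k1', _⟩ := link_facts hT hi hl g1' g3'
      have := F1 hT hi k1 k1' (by omega)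
      rw [if_neg (by omega)] at h2
      omega

lemma drstep (hT : RP T (lam.colLen 0) (lam.rowLen 0)) (hs : Supp lam mu T)
    {i c0 d : ℕ} (hi : i ≠ 0) {l : ℕ → ℕ} (hll : l = lowestLow i lam mu T)
    (h0 : Leftmost T i c0) (hc : Chain T i c0 d) {T' : ℕ → ℕ → ℕ}
    (hst : DRStep i lam mu (st T l i c0 d) T') :
    ∃ e, Chain T i c0 e ∧ T' = st T l i c0 e := by
  have hl : ∀ r c, IsLow T i r c → l c = r := fun r c h => by
    rw [hll]; exact lowestLow_eq hT hs hi h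
  have hcd := hc.1
  have hs' := supp_st (c0 := c0) (d := d) hs l hi
  have hi1 : i + 1 ≠ 0 := by omega
  obtain ⟨e, hst⟩ := hst
  have hdes : ∃ r, IsDescent i lam mu (st T l i c0 d) r e := by
    rcases hst with h | h | h <;> exact h.2.2.1
  obtain ⟨r, _, _, h1, h2⟩ := hdes
  obtain ⟨he, hlink⟩ := step_lemma hT hs hi hl h0 hc h1 h2
  have hcol : ∀ r, st T l i c0 d r e = T r e := fun r => st_out l (Or.inl (by omega)) hcd
  have hHe : Has T (i + 1) e := ⟨r, by rw [← hcol]; exact h1⟩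
  have hLe := chain_no_pure h0 hc he hHe
  have hLe' : ColHasVal lam mu (st T l i c0 d) e i := by
    rw [colHas_iff hs' hi]
    obtain ⟨r, hr⟩ := hLe
    exact ⟨r, by rw [hcol]; exact hr⟩
  have hM1 : StepM1 i lam mu (st T l i c0 d) T' e := by
    rcases hst with h | h | h
    · exact absurd hLe' h.1.2
    · exact h
    · exact absurd hLe' h.1.2
  refine ⟨e, ⟨by omega, ?_⟩, ?_⟩
  · intro c hc1 hc2
    by_cases hce : c = e
    · subst hce; exact ⟨hLe, hHe, hlink⟩
    · exact hc.2 c (by omega) hc2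
  obtain ⟨_, _, _, hF, hA, hB⟩ := hM1
  have hlow : lowestLow i lam mu (st T l i c0 d) e = l e := by
    rw [congrFun hll e]; unfold lowestLow
    simp only [hcol]
  rw [hlow] at hB
  funext r c
  by_cases hb : T r c = i ∨ T r c = i + 1
  · have hb' := (st_band l i c0 d r c).mpr hb
    have hcell : IsSkewCell lam mu r c := (hs r c).mpr (by omega)
    by_cases hce : c = e
    · subst hce
      rw [hA r hcell hb', st_d l hb]
    by_cases hce' : c = e + 1
    · subst hce'
      rw [hB r hcell hb', st_mid l hb (by omega) (by omega), Nat.add_sub_cancel]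
    rw [hF r c (Or.inl (by omega))]
    by_cases hm : e < c ∧ c ≤ c0
    · rw [st_mid l hb (by omega) (by omega), st_mid l hb (by omega) (by omega)]
    · rw [st_out l (by omega) (by omega), st_out l (by omega) (by omega)]
  · have hb' : ¬ InBand i (st T l i c0 d r c) := fun h => hb ((st_band l i c0 d r c).mp h)
    rw [hF r c (Or.inr (fun h => hb' h.2)), st_nband l hb, st_nband l hb]

lemma drsteps (hT : RP T (lam.colLen 0) (lam.rowLen 0)) (hs : Supp lam mu T)
    {i c0 : ℕ} (hi : i ≠ 0) {l : ℕ → ℕ} (hll : l = lowestLow i lam mu T)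
    (h0 : Leftmost T i c0) {T' : ℕ → ℕ → ℕ}
    (hst : Relation.ReflTransGen (DRStep i lam mu) (lowerCol i lam mu T c0) T') :
    ∃ d, Chain T i c0 d ∧ T' = st T l i c0 d := by
  induction hst with
  | refl => exact ⟨c0, ⟨le_rfl, by intros; omega⟩, lowerCol_eq hs l h0.nlow⟩
  | tail _ h ih =>
    obtain ⟨d, hc, rfl⟩ := ih
    exact drstep hT hs hi hll h0 hc h

lemma chain_high {i c0 d : ℕ} (h0 : Leftmost T i c0) (hc : Chain T i c0 d) : Has T (i + 1) d := by
  by_cases h : d = c0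
  · rw [h]; exact h0.high
  · exact (hc.2 d le_rfl (by have := hc.1; omega)).2.1

theorem main_thm {i : ℕ} (hi : 1 ≤ i) (hT' : IsSkewRPP lam mu m T) :
    (eiZero i lam mu T ↔ Eop i (readingWord lam mu T) = none) ∧
    (∀ T', eiRel i lam mu T T' →
      Eop i (readingWord lam mu T) = some (readingWord lam mu T')) := by
  have hT := rp_of hT'
  have hs := supp_of hT'
  have hi0 : i ≠ 0 := by omega
  have hi1 : i + 1 ≠ 0 := by omega
  have hPL := isPL_of hs hi0
  have hRL := isRL_of hs
  refine ⟨⟨?_, ?_⟩, ?_⟩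
  · intro h
    rw [Eop_none_iff, readingWord_eq]
    exact main_none hT hRL hi0 (all_matched_of hPL (lab1 hs hi0) (lab2 hs hi0) h)
  · intro h
    by_contra hne
    unfold eiZero at hne
    obtain ⟨p, ps, hp⟩ := List.exists_cons_of_ne_nil hne
    have hpl : p < (pureCols i lam mu T).length := by
      have : p ∈ unmatchedOpens i (colWord i lam mu T) := by rw [hp]; simp
      unfold unmatchedOpens at this
      have := List.mem_range.mp (List.mem_filter.mp this).1
      unfold colWord at this
      rwa [List.length_map] at this
    have h0 : Leftmost T i ((pureCols i lam mu T)[p]) :=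
      leftmost_of hPL (lab1 hs hi0) (lab2 hs hi0) (p := p) (by
        change (unmatchedOpens i (colWord i lam mu T)).head? = some p
        rw [hp]; rfl) (List.getElem?_eq_getElem hpl)
    obtain ⟨d, hc, hnl⟩ := exists_chain h0
    obtain ⟨r, hr⟩ := chain_high h0 hc
    obtain ⟨b, _, hb⟩ := exists_low hT hi1 hr
    have hmem : (b, d) ∈ RL lam mu T := (hRL.mem b d).mpr (by
      have h1 := hb.1
      have h2 := hb.2
      omega)
    obtain ⟨A, B, hAB⟩ := List.append_of_mem hmem
    have := main_some hT hRL hi0 h0 hc hnl hb hAB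
    rw [← readingWord_eq, h] at this
    cases this
  · rintro T' ⟨p, c0, hp, hc0, hst, hND⟩
    have h0 : Leftmost T i c0 := leftmost_of hPL (lab1 hs hi0) (lab2 hs hi0) hp hc0
    obtain ⟨d, hc, rfl⟩ := drsteps hT hs hi0 rfl h0 hst
    have hcd := hc.1
    have hs' := supp_st (c0 := c0) (d := d) hs (lowestLow i lam mu T) hi0
    have hnd : ∀ r c, ¬ (st T (lowestLow i lam mu T) i c0 d r c = i + 1 ∧
        st T (lowestLow i lam mu T) i c0 d r (c + 1) = i) := by
      rintro r c ⟨h1, h2⟩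
      exact hND r c ⟨(hs' _ _).mpr (by omega), (hs' _ _).mpr (by omega), h1, h2⟩
    have hnl : ∀ e, e + 1 = d → ¬ Link T i e := by
      rintro e rfl ⟨r, h1, h2⟩
      refine hnd r e ⟨?_, ?_⟩
      · rw [st_out _ (Or.inl (by omega)) hcd]; exact h1
      · exact st_d _ (Or.inr h2)
    obtain ⟨r, hr⟩ := chain_high h0 hc
    obtain ⟨b, _, hb⟩ := exists_low hT hi1 hr
    obtain ⟨A, B, hAB, hw⟩ := decomp hT hs hi0
      (fun r c h => lowestLow_eq hT hs hi0 h) h0 hc hnl hnd hb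
    rw [hw, readingWord_eq]
    exact main_some hT hRL hi0 h0 hc hnl hb hAB

end glue
end RPPProof
/-- For every reverse plane partition `T` of shape `lam/mu` with entries in
`[m]`, `E_i(r(T)) = r(e_i(T))`: `e_i(T) = 0` if and only if `E_i(r(T)) = 0`, and whenever
`e_i(T) = T' ≠ 0`, `E_i(r(T)) = r(T')`. -/
theorem Ei_readingWord (lam mu : YoungDiagram) (hsub : mu ≤ lam)
    (m : ℕ) (hm : 2 ≤ m) (i : ℕ) (hi : 1 ≤ i) (him : i < m)
    (T : ℕ → ℕ → ℕ) (hT : IsSkewRPP lam mu m T) :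
    (eiZero i lam mu T ↔ Eop i (readingWord lam mu T) = none) ∧
    (∀ T', eiRel i lam mu T T' →
      Eop i (readingWord lam mu T) = some (readingWord lam mu T')) := by
  exact RPPProof.main_thm hi hT
end

section
/- Fix m ≥ 1 and a partition λ with at most m rows. Any two semistandard Young tableaux of shape λ with entries in [m] can be obtained from one another by applying a finite sequence of the operators E_i and F_i (i ∈ [m−1]) to their row reading words; that is, the row reading words of all SSYT of shape λ with entries in [m] lie in a single connected component of the graph on words with edges s — F_i(s) (F_i(s) ≠ 0). -/
/-- Two words are joined by an edge colored `i` (for some `i ∈ [m-1]`) of the crystal graph on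
words: one is the image of the other under `F_i`. -/
def wordEdge (m : ℕ) (u v : List ℕ) : Prop :=
  ∃ i, 1 ≤ i ∧ i < m ∧ (Fop i u = some v ∨ Fop i v = some u)

/-- `v` lies in the connected component of `u` in the crystal graph on words. -/
def wordComp (m : ℕ) (u v : List ℕ) : Prop :=
  Relation.ReflTransGen (wordEdge m) u v

/-! ### Partitions, semistandard Young tableaux and Schur polynomials -/

/-- `ν : ℕ → ℕ` encodes a partition `(ν 1, ν 2, …)` (the value `ν 0` is normalized to `0`):
the parts weakly decrease and only finitely many are nonzero. -/
def IsPartitionFn (ν : ℕ → ℕ) : Prop :=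
  ν 0 = 0 ∧ (∀ j, ν (j + 2) ≤ ν (j + 1)) ∧ ∃ N, ∀ j, N ≤ j → ν j = 0

/-- `S` is a semistandard Young tableau of shape `ν` with entries in `{1, …, m}`: the cells of
the shape are the `(r, c)` (0-based) with `c < ν (r+1)`; entries weakly increase along rows
and strictly increase down columns; `S` is normalized to be `0` outside the shape. -/
def IsSSYTFn (ν : ℕ → ℕ) (m : ℕ) (S : ℕ → ℕ → ℕ) : Prop :=
  (∀ r c, ¬ c < ν (r + 1) → S r c = 0) ∧
  (∀ r c, c < ν (r + 1) → 1 ≤ S r c ∧ S r c ≤ m) ∧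
  (∀ r c, c + 1 < ν (r + 1) → S r c ≤ S r (c + 1)) ∧
  (∀ r c, c < ν (r + 2) → S r c < S (r + 1) c)

/-- The monomial `x^S = ∏_j x_j^(number of entries of S equal to j)` of a semistandard Young
tableau `S` of shape `ν`. -/
noncomputable def ssytMonom (ν : ℕ → ℕ) (S : ℕ → ℕ → ℕ) : MvPolynomial ℕ ℤ :=
  ∏ᶠ j : ℕ, (MvPolynomial.X j : MvPolynomial ℕ ℤ) ^
    Nat.card {p : ℕ × ℕ // p.2 < ν (p.1 + 1) ∧ S p.1 p.2 = j}

/-- The Schur polynomial `s_ν(x_1, …, x_m)`: the sum of `x^S` over all semistandard Young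
tableaux `S` of shape `ν` with entries in `{1, …, m}`. -/
noncomputable def schurPoly (ν : ℕ → ℕ) (m : ℕ) : MvPolynomial ℕ ℤ :=
  ∑ᶠ S : {S : ℕ → ℕ → ℕ // IsSSYTFn ν m S}, ssytMonom ν S.1

/-- The row reading word of a tableau `S` of shape `ν` (a partition with at most `m` rows):
rows are read left-to-right, from the bottom row to the top row. -/
def rowWord (m : ℕ) (ν : ℕ → ℕ) (S : ℕ → ℕ → ℕ) : List ℕ :=
  ((List.range m).reverse).flatMap fun r => (List.range (ν (r + 1))).map (S r)

theorem aux_range_split (c n : ℕ) (h : c < n) :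
    ∃ L : List ℕ, List.range n = List.range c ++ c :: L ∧ ∀ x ∈ L, c < x ∧ x < n := by
  refine ⟨List.range' (c + 1) (n - c - 1), ?_, ?_⟩
  · have h1 : n = c + ((n - c - 1) + 1) := by omega
    conv_lhs => rw [h1]
    rw [List.range_eq_range', List.range_eq_range', ← List.range'_append_1]
    simp [List.range'_succ]
  · intro x hx
    rw [List.mem_range'_1] at hx
    omega

theorem aux_rev_split (c n : ℕ) (h : c < n) :
    ∃ L : List ℕ, (List.range n).reverse = L ++ c :: (List.range c).reverse ∧
      ∀ x ∈ L, c < x ∧ x < n := by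
  obtain ⟨L, h1, h2⟩ := aux_range_split c n h
  refine ⟨L.reverse, ?_, ?_⟩
  · rw [h1]; simp
  · intro x hx
    exact h2 x (by simpa using hx)

theorem aux_prefD_le (i : ℕ) (A B C : List ℕ) (hA : i ∉ A) (hB : (i + 1) ∉ B)
    (hc : A.count (i + 1) ≤ B.count i) (q : ℕ) (hq : q ≤ (A ++ B).length) :
    prefD i (A ++ B ++ C) q ≤ prefD i (A ++ B ++ C) (A ++ B).length := by
  have e1 : (A ++ B ++ C).take (A ++ B).length = A ++ B := List.take_left
  have e2 : (A ++ B ++ C).take q = A.take q ++ B.take (q - A.length) := by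
    rw [List.take_append_of_le_length hq, List.take_append]
  unfold prefD
  rw [e1, e2]
  have a0 : A.count i = 0 := List.count_eq_zero.2 hA
  have b0 : B.count (i + 1) = 0 := List.count_eq_zero.2 hB
  have a1 : (A.take q).count i ≤ A.count i := (List.take_sublist _ _).count_le _
  have b1 : (B.take (q - A.length)).count i ≤ B.count i := (List.take_sublist _ _).count_le _
  simp only [List.count_append]
  by_cases hqa : q ≤ A.length
  · have : q - A.length = 0 := by omega
    rw [this]
    simp only [List.take_zero, List.count_nil]
    push_cast
    omega
  · have : A.take q = A := List.take_of_length_le (by omega)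
    rw [this]
    push_cast
    omega

theorem aux_Fop (i : ℕ) (A B C : List ℕ) (hA : i ∉ A) (hB : (i + 1) ∉ B) (hC : i ∉ C)
    (hc : A.count (i + 1) ≤ B.count i) :
    Fop i (A ++ B ++ i :: C) = some (A ++ B ++ (i + 1) :: C) := by
  obtain ⟨p, hp⟩ : ∃ p, p = (A ++ B).length := ⟨_, rfl⟩
  obtain ⟨w, hw⟩ : ∃ w, w = A ++ B ++ i :: C := ⟨_, rfl⟩
  have hget : w[p]? = some i := by
    rw [hw, hp]; simp
  have hun : IsUnmatchedClose i w p := by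
    refine ⟨hget, fun q hq => ?_⟩
    have h1 : prefD i w q ≤ prefD i w p := by
      rw [hw, hp]
      exact aux_prefD_le i A B _ hA hB hc q (hp ▸ hq)
    have h2 : prefD i w (p + 1) = prefD i w p + 1 := by
      unfold prefD
      rw [List.take_add_one, hget]
      simp
      ring
    omega
  have hplt : p < w.length := by
    rw [hw, hp]; simp
  obtain ⟨L, hL, hL2⟩ := aux_range_split p w.length hplt
  have hlist : unmatchedCloses i w =
      (List.range p).filter (fun p => decide (IsUnmatchedClose i w p)) ++ [p] := by
    unfold unmatchedCloses
    rw [hL, List.filter_append, List.filter_cons_of_pos (by simpa using hun)]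
    congr 2
    rw [List.filter_eq_nil_iff]
    intro x hx
    have hx2 := hL2 x hx
    simp only [decide_eq_true_eq]
    rintro ⟨h3, -⟩
    apply hC
    have : w[x]? = C[x - p - 1]? := by
      rw [hw, List.getElem?_append_right (by omega), ← hp,
        show x - p = (x - p - 1) + 1 by omega, List.getElem?_cons_succ]
      simp
    rw [this] at h3
    exact List.mem_of_getElem? h3
  have hlast : (unmatchedCloses i w).getLast? = some p := by
    rw [hlist]; simp
  rw [← hw]
  unfold Fop
  rw [hlast]
  simp only [hw, hp]
  simp

theorem aux_lower (ν : ℕ → ℕ) (m : ℕ) (hν : IsPartitionFn ν) (S : ℕ → ℕ → ℕ)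
    (hS : IsSSYTFn ν m S) (r c : ℕ) (h : c < ν (r + 1)) : r + 1 ≤ S r c := by
  induction r with
  | zero => exact (hS.2.1 0 c h).1
  | succ r ih =>
    have h1 := hν.2.1 r
    have h2 := ih (lt_of_lt_of_le h h1)
    have h3 := hS.2.2.2 r c h
    omega

theorem aux_row_mono (ν : ℕ → ℕ) (m : ℕ) (S : ℕ → ℕ → ℕ)
    (hS : IsSSYTFn ν m S) (r c d : ℕ) (hcd : c ≤ d) (h : d < ν (r + 1)) : S r c ≤ S r d := by
  induction d, hcd using Nat.le_induction with
  | base => exact le_rfl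
  | succ d hd ih => exact (ih (by omega)).trans (hS.2.2.1 r d h)

theorem aux_count_map (f : ℕ → ℕ) (n x : ℕ) :
    ((List.range n).map f).count x = Nat.count (fun c => f c = x) n := by
  rw [Nat.count_eq_card_filter_range, List.count, List.countP_map, List.countP_eq_length_filter]
  rw [← List.toFinset_card_of_nodup (List.nodup_range.filter _)]
  congr 1
  ext a
  simp

theorem aux_count_le (p q : ℕ → Prop) [DecidablePred p] [DecidablePred q] (n k : ℕ)
    (h : ∀ c, c < n → p c → c < k ∧ q c) : Nat.count p n ≤ Nat.count q k := by
  rw [Nat.count_eq_card_filter_range, Nat.count_eq_card_filter_range]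
  apply Finset.card_le_card
  intro c hc
  simp only [Finset.mem_filter, Finset.mem_range] at hc ⊢
  exact h c hc.1 hc.2

theorem aux_step (m : ℕ) (ν : ℕ → ℕ) (hν : IsPartitionFn ν) (S : ℕ → ℕ → ℕ)
    (hS : IsSSYTFn ν m S) (hne : ∃ r c, c < ν (r + 1) ∧ S r c ≠ r + 1) 
    (hrows : ∀ j, m < j → ν j = 0) :
    ∃ T, IsSSYTFn ν m T ∧ wordEdge m (rowWord m ν S) (rowWord m ν T) ∧
      (rowWord m ν T).sum < (rowWord m ν S).sum := by
  classical
  have hlow := aux_lower ν m hν S hS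
  have hmono := aux_row_mono ν m S hS
  -- minimal noncanonical value
  have hP : ∃ x, ∃ r c, c < ν (r + 1) ∧ S r c = x ∧ r + 1 < x := by
    obtain ⟨r, c, h1, h2⟩ := hne
    exact ⟨S r c, r, c, h1, rfl, lt_of_le_of_ne (hlow r c h1) (Ne.symm h2)⟩
  obtain ⟨i, hi⟩ : ∃ i, Nat.find hP = i + 1 := by
    obtain ⟨r, c, h1, h2, h3⟩ := Nat.find_spec hP
    exact ⟨Nat.find hP - 1, by omega⟩
  have hcan : ∀ r c, c < ν (r + 1) → S r c ≤ i → S r c = r + 1 := by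
    intro r c h1 h2
    by_contra h3
    have := hlow r c h1
    exact Nat.find_min hP (m := S r c) (by omega) ⟨r, c, h1, rfl, by omega⟩
  have hQ : ∃ d, ∃ r c, c < ν (r + 1) ∧ S r c = i + 1 ∧ r + 1 + d = i := by
    obtain ⟨r, c, h1, h2, h3⟩ := Nat.find_spec hP
    exact ⟨i - r - 1, r, c, h1, by omega, by omega⟩
  obtain ⟨r, c0, hc0, hSc0, hrd⟩ := Nat.find_spec hQ
  have hri : r < i := by omega
  have hmax : ∀ r' c, r < r' → r' < i → c < ν (r' + 1) → S r' c ≠ i + 1 := by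
    intro r' c h1 h2 h3 h4
    exact Nat.find_min hQ (m := i - r' - 1) (by omega) ⟨r', c, h3, h4, by omega⟩
  have hR : ∃ c, c < ν (r + 1) ∧ S r c = i + 1 := ⟨c0, hc0, hSc0⟩
  obtain ⟨c, hc, hSc, hcmin⟩ : ∃ c, c < ν (r + 1) ∧ S r c = i + 1 ∧ ∀ d, d < c → S r d ≠ i + 1 := by
    refine ⟨Nat.find hR, (Nat.find_spec hR).1, (Nat.find_spec hR).2, ?_⟩
    intro d hd h
    exact Nat.find_min hR hd ⟨hd.trans (Nat.find_spec hR).1, h⟩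
  clear hR hQ hrd hc0 hSc0 hi hne
  have him : i + 1 ≤ m := hSc ▸ (hS.2.1 r c hc).2
  obtain ⟨T, hTdef⟩ : ∃ T : ℕ → ℕ → ℕ, T = fun r' c' => if r' = r ∧ c' = c then i else S r' c' :=
    ⟨_, rfl⟩
  have hTc : T r c = i := by simp [hTdef]
  have hTr : ∀ r' c', r' ≠ r → T r' c' = S r' c' := by
    intro r' c' h; simp [hTdef, h]
  have hTcol : ∀ r' c', c' ≠ c → T r' c' = S r' c' := by
    intro r' c' h; simp [hTdef, h]
  have hT : IsSSYTFn ν m T := by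
    refine ⟨?_, ?_, ?_, ?_⟩
    · intro r' c' h
      by_cases h1 : r' = r ∧ c' = c
      · rw [h1.1, h1.2] at h; exact absurd hc h
      · simp only [hTdef, if_neg h1]; exact hS.1 r' c' h
    · intro r' c' h
      by_cases h1 : r' = r ∧ c' = c
      · simp only [hTdef, if_pos h1]; omega
      · simp only [hTdef, if_neg h1]; exact hS.2.1 r' c' h
    · intro r' c' h
      have h0 := hS.2.2.1 r' c' h
      by_cases hr : r' = r
      · subst hr
        by_cases h1 : c' = c
        · subst h1
          rw [hTc, hTcol _ _ (by omega)]; omega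
        · by_cases h2 : c' + 1 = c
          · subst h2
            have := hcmin c' (by omega)
            rw [hTc, hTcol _ _ (by omega)]; omega
          · rw [hTcol _ _ h1, hTcol _ _ h2]; exact h0
      · rw [hTr _ _ hr, hTr _ _ hr]; exact h0
    · intro r' c' h
      have h0 := hS.2.2.2 r' c' h
      by_cases hr : c' = c
      · subst hr
        by_cases h1 : r' = r
        · subst h1
          rw [hTc, hTr _ _ (by omega)]; omega
        · by_cases h2 : r' + 1 = r
          · subst h2
            rw [hTc, hTr _ _ (by omega)]
            have h5 := hcan r' c' (lt_of_lt_of_le h (hν.2.1 r')) (by omega)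
            omega
          · rw [hTr _ _ h1, hTr _ _ h2]; exact h0
      · rw [hTcol _ _ hr, hTcol _ _ hr]; exact h0
  obtain ⟨X, hX, hX2⟩ := aux_rev_split i m (by omega)
  obtain ⟨Y, hY, hY2⟩ := aux_rev_split r i hri
  obtain ⟨Z, hZ, hZ2⟩ := aux_range_split c (ν (r + 1)) hc
  obtain ⟨row, hrow⟩ : ∃ row : ℕ → List ℕ, row = fun r => (List.range (ν (r + 1))).map (S r) :=
    ⟨_, rfl⟩
  obtain ⟨A, hA⟩ : ∃ A, A = X.flatMap row ++ row i := ⟨_, rfl⟩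
  obtain ⟨B, hB⟩ : ∃ B, B = Y.flatMap row ++ (List.range c).map (S r) := ⟨_, rfl⟩
  obtain ⟨C, hC⟩ : ∃ C, C = Z.map (S r) ++ (List.range r).reverse.flatMap row := ⟨_, rfl⟩
  have hwS : rowWord m ν S = A ++ B ++ (i + 1) :: C := by
    unfold rowWord
    rw [← hrow, hX, hY, hA, hB, hC]
    simp only [List.flatMap_append, List.flatMap_cons]
    have : row r = (List.range c).map (S r) ++ (i + 1) :: Z.map (S r) := by
      rw [hrow]; simp only [hZ, List.map_append, List.map_cons, hSc]
    rw [this]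
    simp only [List.append_assoc, List.cons_append]
  have hrowT : ∀ r', r' ≠ r → (List.range (ν (r' + 1))).map (T r') = row r' := by
    intro r' h
    rw [hrow]
    apply List.map_congr_left
    intro c' _
    exact hTr r' c' h
  have hflat : ∀ L : List ℕ, r ∉ L →
      L.flatMap (fun r => (List.range (ν (r + 1))).map (T r)) = L.flatMap row := by
    intro L hL
    apply List.flatMap_congr
    intro a ha
    exact hrowT a (fun h => hL (h ▸ ha))
  have hwT : rowWord m ν T = A ++ B ++ i :: C := by
    unfold rowWord
    rw [hX, hY, hA, hB, hC]
    simp only [List.flatMap_append, List.flatMap_cons]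
    rw [hflat X (fun h => by have := hX2 _ h; omega), hflat Y (fun h => by have := hY2 _ h; omega),
      hflat (List.range r).reverse (by simp), hrowT i (by omega)]
    have : (List.range (ν (r + 1))).map (T r) =
        (List.range c).map (S r) ++ i :: Z.map (S r) := by
      simp only [hZ, List.map_append, List.map_cons, hTc]
      congr 1
      · apply List.map_congr_left
        intro a ha
        exact hTcol r a (by have := List.mem_range.1 ha; omega)
      · congr 1
        apply List.map_congr_left
        intro a ha
        exact hTcol r a (by have := hZ2 a ha; omega)
    rw [this]
    simp only [List.append_assoc, List.cons_append]
  have hmemrow : ∀ x r', x ∈ row r' → ∃ c', c' < ν (r' + 1) ∧ S r' c' = x := by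
    intro x r' h
    rw [hrow] at h
    simpa using h
  have hiA : i ∉ A := by
    rw [hA, List.mem_append, List.mem_flatMap]
    rintro (⟨a, ha, h⟩ | h)
    · obtain ⟨c', h1, h2⟩ := hmemrow _ _ h
      have := hX2 a ha
      have := hlow _ _ h1
      omega
    · obtain ⟨c', h1, h2⟩ := hmemrow _ _ h
      have := hlow _ _ h1
      omega
  have hiB : (i + 1) ∉ B := by
    rw [hB, List.mem_append, List.mem_flatMap]
    rintro (⟨a, ha, h⟩ | h)
    · obtain ⟨c', h1, h2⟩ := hmemrow _ _ h
      have := hY2 a ha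
      exact hmax a c' this.1 this.2 h1 h2
    · obtain ⟨c', h1, h2⟩ := List.mem_map.1 h
      exact hcmin c' (List.mem_range.1 h1) h2
  have hiC : i ∉ C := by
    rw [hC, List.mem_append, List.mem_flatMap]
    rintro (h | ⟨a, ha, h⟩)
    · obtain ⟨c', h1, h2⟩ := List.mem_map.1 h
      have h3 := hZ2 c' h1
      have := hmono r c c' h3.1.le h3.2
      omega
    · obtain ⟨c', h1, h2⟩ := hmemrow _ _ h
      have h3 := hcan a c' h1 (by omega)
      have : a < r := by simpa using ha
      omega
  have hX0 : (X.flatMap row).count (i + 1) = 0 := by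
    rw [List.count_eq_zero, List.mem_flatMap]
    rintro ⟨a, ha, h⟩
    obtain ⟨c', h1, h2⟩ := hmemrow _ _ h
    have := hX2 a ha
    have := hlow _ _ h1
    omega
  -- columns with i+1 in row i have i above
  obtain ⟨j, rfl⟩ : ∃ j, i = j + 1 := ⟨i - 1, by omega⟩
  have habove : ∀ c', c' < ν (j + 2) → S (j + 1) c' = j + 2 → c' < ν (j + 1) ∧ S j c' = j + 1 := by
    intro c' h1 h2
    have h3 := lt_of_lt_of_le h1 (hν.2.1 j)
    have h4 := hS.2.2.2 j c' h1
    have h5 := hlow j c' h3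
    exact ⟨h3, by omega⟩
  have hcnt : A.count (j + 1 + 1) ≤ B.count (j + 1) := by
    rw [hA, List.count_append, hX0, zero_add, hB, List.count_append]
    by_cases hrj : r = j
    · subst hrj
      have : (row (r + 1)).count (r + 1 + 1) ≤ ((List.range c).map (S r)).count (r + 1) := by
        rw [hrow]
        simp only [aux_count_map]
        apply aux_count_le
        intro c' h1 h2
        obtain ⟨h3, h4⟩ := habove c' h1 h2
        refine ⟨?_, h4⟩
        by_contra h5
        have := hmono r c c' (by omega) h3
        omega
      omega
    · have hjY : j ∈ Y := by
        have : j ∈ (List.range (j + 1)).reverse := by simp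
        rw [hY] at this
        simp only [List.mem_append, List.mem_cons, List.mem_reverse, List.mem_range] at this
        rcases this with h | h | h
        · exact h
        · omega
        · omega
      have h1 : (row (j + 1)).count (j + 1 + 1) ≤ (row j).count (j + 1) := by
        rw [hrow]
        simp only [aux_count_map]
        apply aux_count_le
        intro c' h1 h2
        exact habove c' h1 h2
      have h2 : (row j).count (j + 1) ≤ (Y.flatMap row).count (j + 1) := by
        obtain ⟨Y1, Y2, rfl⟩ := List.append_of_mem hjY
        simp only [List.flatMap_append, List.flatMap_cons, List.count_append]
        omega
      omega
  refine ⟨T, hT, ⟨j + 1, by omega, by omega, Or.inr ?_⟩, ?_⟩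
  · rw [hwS, hwT]
    exact aux_Fop (j + 1) A B C hiA hiB hiC hcnt
  · rw [hwS, hwT]
    simp

theorem aux_symm (m : ℕ) (u v : List ℕ) (h : wordComp m u v) : wordComp m v u := by
  unfold wordComp at *
  induction h with
  | refl => exact Relation.ReflTransGen.refl
  | tail _ hbc ih =>
    obtain ⟨i, h1, h2, h3⟩ := hbc
    exact Relation.ReflTransGen.head ⟨i, h1, h2, h3.symm⟩ ih

theorem aux_reach (m : ℕ) (ν : ℕ → ℕ) (hν : IsPartitionFn ν) (hrows : ∀ j, m < j → ν j = 0)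
    (n : ℕ) : ∀ S, IsSSYTFn ν m S → (rowWord m ν S).sum ≤ n →
    wordComp m (rowWord m ν S) (rowWord m ν (fun r _ => r + 1)) := by
  induction n with
  | zero =>
    intro S hS hn
    by_cases hne : ∃ r c, c < ν (r + 1) ∧ S r c ≠ r + 1
    · obtain ⟨T, _, _, h3⟩ := aux_step m ν hν S hS hne hrows
      omega
    · push Not at hne
      have : rowWord m ν S = rowWord m ν (fun r _ => r + 1) := by
        unfold rowWord
        apply List.flatMap_congr
        intro r _
        apply List.map_congr_left
        intro c hc
        exact hne r c (List.mem_range.1 hc)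
      rw [this]
      exact Relation.ReflTransGen.refl
  | succ n ih =>
    intro S hS hn
    by_cases hne : ∃ r c, c < ν (r + 1) ∧ S r c ≠ r + 1
    · obtain ⟨T, h1, h2, h3⟩ := aux_step m ν hν S hS hne hrows
      exact Relation.ReflTransGen.head h2 (ih T h1 (by omega))
    · push Not at hne
      have : rowWord m ν S = rowWord m ν (fun r _ => r + 1) := by
        unfold rowWord
        apply List.flatMap_congr
        intro r _
        apply List.map_congr_left
        intro c hc
        exact hne r c (List.mem_range.1 hc)
      rw [this]
      exact Relation.ReflTransGen.refl

/-- Any two SSYT of the same shape `λ` (a partition with at most `m` rows)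
with entries in `[m]` can be obtained from one another by a finite sequence of the operators
`E_i`, `F_i`: their row reading words lie in a single connected component of the crystal
graph on words. -/
theorem ssyt_single_component (m : ℕ) (hm : 1 ≤ m) (ν : ℕ → ℕ)
    (hν : IsPartitionFn ν) (hrows : ∀ j, m < j → ν j = 0)
    (S S' : ℕ → ℕ → ℕ) (hS : IsSSYTFn ν m S) (hS' : IsSSYTFn ν m S') :
    wordComp m (rowWord m ν S) (rowWord m ν S') := by
  exact Relation.ReflTransGen.trans (aux_reach m ν hν hrows _ S hS le_rfl)
    (aux_symm m _ _ (aux_reach m ν hν hrows _ S' hS' le_rfl))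
end

section
/- Fix i ≥ 1 and a skew shape λ/μ, and let T be a reverse plane partition of shape λ/μ all of whose entries are i or i+1. An i-pure column of T is unmatched in the column parenthesis matching of T if and only if the entry of the reading word r(T) contributed by that column (an i) is unmatched in the parenthesis matching of the word r(T); moreover the order of pure columns agrees with the order of their contributed entries in r(T), so the unmatched i-pure columns of T correspond exactly, in left-to-right order, to the unmatched i's of r(T). -/
/-- The cell `(r, c)` contributes an entry to the reading word: it is a cell of the shape and
its entry differs from the entry directly below it (if any). -/
def Survives (lam mu : YoungDiagram) (T : ℕ → ℕ → ℕ) (r c : ℕ) : Prop :=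
  IsSkewCell lam mu r c ∧ ¬ (IsSkewCell lam mu (r + 1) c ∧ T (r + 1) c = T r c)

/-- The (0-based) position, in the reading word, of the entry contributed by the surviving
cell `(r, c)`: the number of surviving cells read before it (those in strictly lower rows,
or in the same row strictly to the left). -/
noncomputable def posOf (lam mu : YoungDiagram) (T : ℕ → ℕ → ℕ) (r c : ℕ) : ℕ :=
  Nat.card {p : ℕ × ℕ // Survives lam mu T p.1 p.2 ∧ (r < p.1 ∨ (p.1 = r ∧ p.2 < c))}

/-- The (0-based) row index of the bottom cell of column `c`; in a column all of whose
entries are `i` or `i+1`, the bottom cell is the one contributing the column's letter (its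
`i` if the column is `i`-pure, its `i+1` if it is `(i+1)`-pure) to the reading word. -/
noncomputable def colBtm (lam mu : YoungDiagram) (c : ℕ) : ℕ :=
  sSup {r | IsSkewCell lam mu r c}

/-! ### Abstract lemmas on words -/

theorem pcm_prefD_zero (i : ℕ) (w : List ℕ) : prefD i w 0 = 0 := by simp [prefD]

/-- Number of selected elements among the first `q`. -/
def pcmKap {α : Type} (P : α → Bool) (L : List α) (q : ℕ) : ℕ := ((L.take q).filter P).length

theorem pcm_take_kap {α : Type} (P : α → Bool) (L : List α) (q : ℕ) :
    (L.filter P).take (pcmKap P L q) = (L.take q).filter P := by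
  have h : L.filter P = (L.take q).filter P ++ (L.drop q).filter P := by
    rw [← List.filter_append, List.take_append_drop]
  rw [h, pcmKap, List.take_left]

theorem pcm_kap_succ {α : Type} (P : α → Bool) (L : List α) (q : ℕ) (x : α)
    (hx : L[q]? = some x) : pcmKap P L (q + 1) = pcmKap P L q + if P x then 1 else 0 := by
  unfold pcmKap
  rw [List.take_add_one, hx]
  simp only [Option.toList_some, List.filter_append, List.length_append]
  congr 1
  by_cases h : P x <;> simp [h]

theorem pcm_kap_get {α : Type} (P : α → Bool) (L : List α) (q : ℕ) (x : α)
    (hx : L[q]? = some x) (hP : P x = true) : (L.filter P)[pcmKap P L q]? = some x := by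
  have h1 := pcm_take_kap P L (q + 1)
  have h2 := pcm_kap_succ P L q x hx
  rw [h2] at h1
  simp only [hP, if_true] at h1
  rw [List.take_add_one, pcm_take_kap, List.take_add_one, hx] at h1
  simp only [Option.toList_some, List.filter_append] at h1
  have h3 := List.append_cancel_left h1
  simp only [List.filter_cons, hP, if_true, List.filter_nil] at h3
  cases h : (L.filter P)[pcmKap P L q]? with
  | none => rw [h] at h3; simp at h3
  | some y => rw [h] at h3; simpa using h3

theorem pcm_prefD_succ {α : Type} (i : ℕ) (f : α → ℕ) (L : List α) (p : ℕ) (x : α)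
    (hx : L[p]? = some x) (hf : f x = i ∨ f x = i + 1) :
    prefD i (L.map f) (p + 1) = prefD i (L.map f) p + if f x = i then 1 else -1 := by
  unfold prefD
  rw [List.take_add_one, List.getElem?_map, hx]
  simp only [Option.map_some, Option.toList_some, List.count_append, List.count_singleton]
  rcases hf with h | h <;> simp [h] <;> ring

/-- the reachable values of `pcmKap` -/
theorem pcm_kap_surj {α : Type} (P : α → Bool) (L : List α) (p : ℕ) :
    ∀ k ≤ pcmKap P L p, ∃ q ≤ p, pcmKap P L q = k := by
  induction p with
  | zero => intro k hk; exact ⟨0, le_rfl, by simp [pcmKap] at hk ⊢; omega⟩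
  | succ p ih =>
    intro k hk
    cases hx : L[p]? with
    | none =>
      have : pcmKap P L (p + 1) = pcmKap P L p := by
        simp [pcmKap, List.take_add_one, hx]
      rw [this] at hk
      obtain ⟨q, h1, h2⟩ := ih k hk
      exact ⟨q, by omega, h2⟩
    | some x =>
      have := pcm_kap_succ P L p x hx
      by_cases h : k ≤ pcmKap P L p
      · obtain ⟨q, h1, h2⟩ := ih k h
        exact ⟨q, by omega, h2⟩
      · refine ⟨p + 1, le_rfl, ?_⟩
        split_ifs at this <;> omega

theorem pcm_kap_mono {α : Type} (P : α → Bool) (L : List α) (q p : ℕ) (h : q ≤ p) :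
    pcmKap P L q ≤ pcmKap P L p := by
  unfold pcmKap
  exact ((List.take_sublist_take_left h).filter P).length_le

/-- The main abstract lemma. -/
theorem pcm_abstract {α : Type} (i : ℕ) (P : α → Bool) (f : α → ℕ) (L : List α)
    (hf : ∀ x ∈ L, f x = i ∨ f x = i + 1)
    (h0 : ∀ q, prefD i (L.map f) q ≤ prefD i ((L.filter P).map f) (pcmKap P L q))
    (h1 : ∀ p x, L[p]? = some x → P x = true → f x = i →
      prefD i ((L.filter P).map f) (pcmKap P L p) ≤ prefD i (L.map f) p)
    (h2 : ∀ p x, L[p]? = some x → P x = false → f x = i →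
      prefD i (L.map f) p < prefD i ((L.filter P).map f) (pcmKap P L p))
    (p : ℕ) (x : α) (hx : L[p]? = some x) :
    IsUnmatchedClose i (L.map f) p ↔
      (P x = true ∧ IsUnmatchedClose i ((L.filter P).map f) (pcmKap P L p)) := by
  have hC : ∀ q y, L[q]? = some y → P y = true →
      prefD i ((L.filter P).map f) (pcmKap P L (q + 1)) =
        prefD i ((L.filter P).map f) (pcmKap P L q) + if f y = i then 1 else -1 := by
    intro q y hy hP
    rw [pcm_kap_succ P L q y hy, if_pos hP]
    exact pcm_prefD_succ i f _ _ y (pcm_kap_get P L q y hy hP) (hf y (List.mem_of_getElem? hy))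
  have hC' : ∀ q y, L[q]? = some y → P y = false →
      prefD i ((L.filter P).map f) (pcmKap P L (q + 1)) =
        prefD i ((L.filter P).map f) (pcmKap P L q) := by
    intro q y hy hP
    rw [pcm_kap_succ P L q y hy, if_neg (by simp [hP]), add_zero]
  have hW : ∀ q y, L[q]? = some y → prefD i (L.map f) (q + 1) =
      prefD i (L.map f) q + if f y = i then 1 else -1 := fun q y hy =>
    pcm_prefD_succ i f L q y hy (hf y (List.mem_of_getElem? hy))
  have key : ∀ q, ∃ q0 ≤ q,
      prefD i ((L.filter P).map f) (pcmKap P L q) ≤ prefD i (L.map f) q0 := by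
    intro q
    induction q with
    | zero => exact ⟨0, le_rfl, by simp [pcmKap, pcm_prefD_zero]⟩
    | succ q ih =>
      obtain ⟨q0, hq0, hle⟩ := ih
      cases hy : L[q]? with
      | none =>
        have : pcmKap P L (q + 1) = pcmKap P L q := by
          simp [pcmKap, List.take_add_one, hy]
        exact ⟨q0, by omega, by rw [this]; exact hle⟩
      | some y =>
        cases hP : P y with
        | false => exact ⟨q0, by omega, by rw [hC' q y hy hP]; exact hle⟩
        | true =>
          by_cases hi : f y = i
          · refine ⟨q + 1, le_rfl, ?_⟩
            rw [hC q y hy hP, hW q y hy]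
            have := h1 q y hy hP hi
            omega
          · refine ⟨q0, by omega, ?_⟩
            rw [hC q y hy hP, if_neg hi]
            omega
  constructor
  · rintro ⟨ha, hb⟩
    have hfx : f x = i := by simpa [hx] using ha
    have hw := hW p x hx
    rw [if_pos hfx] at hw
    obtain ⟨q0, hq0, hle⟩ := key p
    have hb0 := hb q0 hq0
    cases hP : P x with
    | false =>
      have := h2 p x hx hP hfx
      omega
    | true =>
      refine ⟨rfl, by simp [pcm_kap_get P L p x hx hP, hfx], ?_⟩
      intro k hk
      obtain ⟨q, hq, rfl⟩ := pcm_kap_surj P L p k hk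
      obtain ⟨q1, hq1, hle1⟩ := key q
      have hb1 := hb q1 (by omega)
      have hc := hC p x hx hP
      rw [if_pos hfx, pcm_kap_succ P L p x hx, if_pos hP] at hc
      have := h0 p
      omega
  · rintro ⟨hP, ha, hb⟩
    have hfx : f x = i := by simpa [pcm_kap_get P L p x hx hP] using ha
    refine ⟨by simp [hx, hfx], ?_⟩
    intro q hq
    have hb1 := hb _ (pcm_kap_mono P L q p hq)
    have hc := hC p x hx hP
    rw [if_pos hfx, pcm_kap_succ P L p x hx, if_pos hP] at hc
    have hw := hW p x hx
    rw [if_pos hfx] at hw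
    have := h0 q
    have := h1 p x hx hP hfx
    omega

/-! ### The list of surviving cells in reading order -/

/-- `x` is read before `y`. -/
def pcmBef (x y : ℕ × ℕ) : Prop := y.1 < x.1 ∨ (x.1 = y.1 ∧ x.2 < y.2)

/-- The surviving cells, in reading order. -/
def pcmCells (lam mu : YoungDiagram) (T : ℕ → ℕ → ℕ) : List (ℕ × ℕ) :=
  ((List.range (lam.colLen 0)).reverse).flatMap fun r =>
    ((List.range (lam.rowLen r)).filter fun c =>
      decide (IsSkewCell lam mu r c) &&
        ! (decide (IsSkewCell lam mu (r + 1) c) && decide (T (r + 1) c = T r c))).map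
      fun c => (r, c)

theorem pcm_readingWord (lam mu : YoungDiagram) (T : ℕ → ℕ → ℕ) :
    readingWord lam mu T = (pcmCells lam mu T).map fun x => T x.1 x.2 := by
  unfold readingWord pcmCells
  rw [List.map_flatMap]
  simp only [List.map_map]
  rfl

theorem pcm_cell_iff (lam mu : YoungDiagram) (r c : ℕ) :
    IsSkewCell lam mu r c ↔ mu.colLen c ≤ r ∧ r < lam.colLen c := by
  unfold IsSkewCell
  rw [YoungDiagram.mem_cells, YoungDiagram.mem_cells, YoungDiagram.mem_iff_lt_colLen,
    YoungDiagram.mem_iff_lt_colLen]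
  omega

theorem pcm_mem_cells (lam mu : YoungDiagram) (T : ℕ → ℕ → ℕ) (x : ℕ × ℕ) :
    x ∈ pcmCells lam mu T ↔ Survives lam mu T x.1 x.2 := by
  obtain ⟨r, c⟩ := x
  unfold pcmCells Survives
  simp only [List.mem_flatMap, List.mem_reverse, List.mem_range, List.mem_map, List.mem_filter,
    Prod.mk.injEq, Bool.and_eq_true, decide_eq_true_eq, Bool.not_eq_true', Bool.and_eq_false_iff,
    decide_eq_false_iff_not]
  constructor
  · rintro ⟨r', h1, c', ⟨h2, h3, h4⟩, rfl, rfl⟩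
    exact ⟨h3, by tauto⟩
  · rintro ⟨h1, h2⟩
    refine ⟨r, ?_, c, ⟨?_, h1, by tauto⟩, rfl, rfl⟩
    · have h := (pcm_cell_iff lam mu r c).1 h1
      have := lam.colLen_anti 0 c (by omega)
      omega
    · rw [← YoungDiagram.mem_iff_lt_rowLen]
      exact h1.1

theorem pcm_pairwise (lam mu : YoungDiagram) (T : ℕ → ℕ → ℕ) :
    (pcmCells lam mu T).Pairwise pcmBef := by
  unfold pcmCells
  rw [List.pairwise_flatMap]
  constructor
  · intro r _
    rw [List.pairwise_map]
    refine List.Pairwise.filter _ (List.pairwise_lt_range.imp ?_)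
    intro a b h
    exact Or.inr ⟨rfl, h⟩
  · rw [List.pairwise_reverse]
    refine List.pairwise_lt_range.imp ?_
    intro a b h x hx y hy
    simp only [List.mem_map] at hx hy
    obtain ⟨_, _, rfl⟩ := hx
    obtain ⟨_, _, rfl⟩ := hy
    exact Or.inl h

theorem pcm_bef_asymm {x y : ℕ × ℕ} (h : pcmBef x y) (h' : pcmBef y x) : False := by
  unfold pcmBef at *; omega

theorem pcm_nodup (lam mu : YoungDiagram) (T : ℕ → ℕ → ℕ) : (pcmCells lam mu T).Nodup := by
  refine (pcm_pairwise lam mu T).imp ?_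
  rintro a b h rfl
  exact pcm_bef_asymm h h

theorem pcm_take_closed (lam mu : YoungDiagram) (T : ℕ → ℕ → ℕ) (q : ℕ) (x y : ℕ × ℕ)
    (hx : x ∈ (pcmCells lam mu T).take q) (hy : y ∈ pcmCells lam mu T) (h : pcmBef y x) :
    y ∈ (pcmCells lam mu T).take q := by
  have hp := pcm_pairwise lam mu T
  rw [← List.take_append_drop q (pcmCells lam mu T)] at hp hy
  rw [List.pairwise_append] at hp
  rcases List.mem_append.1 hy with h1 | h1
  · exact h1
  · exact (pcm_bef_asymm h (hp.2.2 x hx y h1)).elim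

theorem pcm_mem_take (lam mu : YoungDiagram) (T : ℕ → ℕ → ℕ) (p : ℕ) (x y : ℕ × ℕ)
    (hx : (pcmCells lam mu T)[p]? = some x) :
    y ∈ (pcmCells lam mu T).take p ↔ y ∈ pcmCells lam mu T ∧ pcmBef y x := by
  have hp := pcm_pairwise lam mu T
  obtain ⟨hlt, rfl⟩ := List.getElem?_eq_some_iff.1 hx
  have he : pcmCells lam mu T = (pcmCells lam mu T).take p ++
      (pcmCells lam mu T)[p] :: (pcmCells lam mu T).drop (p + 1) := by
    rw [List.cons_getElem_drop_succ, List.take_append_drop]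
  set z := (pcmCells lam mu T)[p] with hz
  rw [he, List.pairwise_append] at hp
  constructor
  · intro h
    exact ⟨List.mem_of_mem_take h, hp.2.2 y h z (by simp)⟩
  · rintro ⟨h1, h2⟩
    rw [he] at h1
    rcases List.mem_append.1 h1 with h | h
    · exact h
    · rcases List.mem_cons.1 h with h | h
      · subst h; exact (pcm_bef_asymm h2 h2).elim
      · exact (pcm_bef_asymm h2 ((List.pairwise_cons.1 hp.2.1).1 y h)).elim

theorem pcm_posOf (lam mu : YoungDiagram) (T : ℕ → ℕ → ℕ) (p : ℕ) (x : ℕ × ℕ)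
    (hx : (pcmCells lam mu T)[p]? = some x) : posOf lam mu T x.1 x.2 = p := by
  unfold posOf
  have hlt := (List.getElem?_eq_some_iff.1 hx).1
  have h1 : ∀ y : ℕ × ℕ, (Survives lam mu T y.1 y.2 ∧ (x.1 < y.1 ∨ (y.1 = x.1 ∧ y.2 < x.2))) ↔
      y ∈ ((pcmCells lam mu T).take p).toFinset := by
    intro y
    rw [List.mem_toFinset, pcm_mem_take lam mu T p x y hx, pcm_mem_cells]
    rfl
  rw [Nat.card_congr (Equiv.subtypeEquivRight h1), Nat.card_eq_fintype_card, Fintype.card_coe,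
    List.toFinset_card_of_nodup ((pcm_nodup lam mu T).sublist (List.take_sublist _ _))]
  simp; omega

/-! ### Facts on the tableau -/

section Tab

/-- Selection of the cells in pure columns. -/
def pcmP (i : ℕ) (lam mu : YoungDiagram) (T : ℕ → ℕ → ℕ) (x : ℕ × ℕ) : Bool :=
  decide (IsPureLow i lam mu T x.2) || decide (IsPureHigh i lam mu T x.2)

theorem pcm_hasVal (lam mu : YoungDiagram) (T : ℕ → ℕ → ℕ) (c v : ℕ) :
    ColHasVal lam mu T c v ↔ ∃ r, mu.colLen c ≤ r ∧ r < lam.colLen c ∧ T r c = v := by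
  unfold ColHasVal
  simp only [Finset.mem_range, pcm_cell_iff]
  constructor
  · rintro ⟨r, h1, h2, h3⟩; exact ⟨r, h2.1, h1, h3⟩
  · rintro ⟨r, h1, h2, h3⟩; exact ⟨r, h2, ⟨h1, h2⟩, h3⟩

theorem pcm_btm (lam mu : YoungDiagram) (c : ℕ) (h : mu.colLen c < lam.colLen c) :
    colBtm lam mu c = lam.colLen c - 1 := by
  unfold colBtm
  apply IsGreatest.csSup_eq
  constructor
  · rw [Set.mem_ofPred_eq, pcm_cell_iff]; omega
  · intro r hr
    rw [Set.mem_ofPred_eq, pcm_cell_iff] at hr; omega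

variable {i : ℕ} {lam mu : YoungDiagram} {T : ℕ → ℕ → ℕ}

theorem pcm_col_mono (hT : IsSkewRPP lam mu (i + 1) T) (c r r' : ℕ) (h : r ≤ r')
    (h1 : mu.colLen c ≤ r) (h2 : r' < lam.colLen c) : T r c ≤ T r' c := by
  induction r', h using Nat.le_induction with
  | base => exact le_rfl
  | succ s hs ih =>
    refine (ih (by omega)).trans (hT.2.2.2 s c ?_ ?_) <;> rw [pcm_cell_iff] <;> omega

theorem pcm_row_mono (hT : IsSkewRPP lam mu (i + 1) T) (r c c' : ℕ) (h : c ≤ c')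
    (h1 : mu.colLen c ≤ r) (h2 : r < lam.colLen c') : T r c ≤ T r c' := by
  induction c', h using Nat.le_induction with
  | base => exact le_rfl
  | succ s hs ih =>
    have a1 := lam.colLen_anti s (s + 1) (by omega)
    have a2 := mu.colLen_anti s (s + 1) (by omega)
    have a3 := mu.colLen_anti c s hs
    refine (ih (by omega)).trans (hT.2.2.1 r s ?_ ?_) <;> rw [pcm_cell_iff] <;> omega

/-- A surviving cell is the bottom of its column, or an `i` above an `i+1`. -/
theorem pcm_surv (hT : IsSkewRPP lam mu (i + 1) T)
    (hband : ∀ r c, IsSkewCell lam mu r c → InBand i (T r c)) (r c : ℕ) :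
    Survives lam mu T r c ↔ mu.colLen c ≤ r ∧
      (r + 1 = lam.colLen c ∨ (r + 1 < lam.colLen c ∧ T r c = i ∧ T (r + 1) c = i + 1)) := by
  unfold Survives
  constructor
  · rintro ⟨h1, h2⟩
    have hb := hband _ _ h1
    rw [pcm_cell_iff] at h1
    refine ⟨h1.1, ?_⟩
    by_cases h : r + 1 = lam.colLen c
    · exact Or.inl h
    · right
      have h3 : IsSkewCell lam mu (r + 1) c := by rw [pcm_cell_iff]; omega
      have hb' := hband _ _ h3
      have hm := pcm_col_mono hT c r (r + 1) (by omega) h1.1 (by omega)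
      have h4 : T (r + 1) c ≠ T r c := fun h => h2 ⟨h3, h⟩
      unfold InBand at hb hb'
      omega
  · rintro ⟨h1, h2⟩
    rw [pcm_cell_iff, pcm_cell_iff]
    omega

theorem pcm_band (hband : ∀ r c, IsSkewCell lam mu r c → InBand i (T r c)) (r c : ℕ)
    (h1 : mu.colLen c ≤ r) (h2 : r < lam.colLen c) : T r c = i ∨ T r c = i + 1 :=
  hband r c ((pcm_cell_iff lam mu r c).2 ⟨h1, h2⟩)

theorem pcm_pureLow (hT : IsSkewRPP lam mu (i + 1) T)
    (hband : ∀ r c, IsSkewCell lam mu r c → InBand i (T r c)) (c : ℕ) :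
    IsPureLow i lam mu T c ↔
      mu.colLen c < lam.colLen c ∧ T (lam.colLen c - 1) c = i := by
  unfold IsPureLow
  rw [pcm_hasVal, pcm_hasVal]
  constructor
  · rintro ⟨⟨r, h1, h2, h3⟩, h4⟩
    refine ⟨by omega, ?_⟩
    rcases pcm_band hband (lam.colLen c - 1) c (by omega) (by omega) with h | h
    · exact h
    · exact (h4 ⟨_, by omega, by omega, h⟩).elim
  · rintro ⟨h1, h2⟩
    refine ⟨⟨_, by omega, by omega, h2⟩, ?_⟩
    rintro ⟨r, h3, h4, h5⟩
    have := pcm_col_mono hT c r (lam.colLen c - 1) (by omega) h3 (by omega)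
    omega

theorem pcm_pureHigh (hT : IsSkewRPP lam mu (i + 1) T)
    (hband : ∀ r c, IsSkewCell lam mu r c → InBand i (T r c)) (c : ℕ) :
    IsPureHigh i lam mu T c ↔
      mu.colLen c < lam.colLen c ∧ T (mu.colLen c) c = i + 1 := by
  unfold IsPureHigh
  rw [pcm_hasVal, pcm_hasVal]
  constructor
  · rintro ⟨⟨r, h1, h2, h3⟩, h4⟩
    refine ⟨by omega, ?_⟩
    rcases pcm_band hband (mu.colLen c) c (by omega) (by omega) with h | h
    · exact (h4 ⟨_, by omega, by omega, h⟩).elim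
    · exact h
  · rintro ⟨h1, h2⟩
    refine ⟨⟨_, by omega, by omega, h2⟩, ?_⟩
    rintro ⟨r, h3, h4, h5⟩
    have := pcm_col_mono hT c (mu.colLen c) r (by omega) le_rfl (by omega)
    omega

/-- A surviving cell in a pure column is the bottom cell. -/
theorem pcm_pure_surv (hT : IsSkewRPP lam mu (i + 1) T)
    (hband : ∀ r c, IsSkewCell lam mu r c → InBand i (T r c)) (r c : ℕ)
    (hs : Survives lam mu T r c) (hp : IsPureLow i lam mu T c ∨ IsPureHigh i lam mu T c) :
    r + 1 = lam.colLen c := by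
  rw [pcm_pureLow hT hband, pcm_pureHigh hT hband] at hp
  rw [pcm_surv hT hband] at hs
  rcases hs with ⟨h1, h2 | ⟨h2, h3, h4⟩⟩
  · exact h2
  · rcases hp with ⟨h5, h6⟩ | ⟨h5, h6⟩
    · have := pcm_col_mono hT c (r + 1) (lam.colLen c - 1) (by omega) (by omega) (by omega)
      omega
    · have := pcm_col_mono hT c (mu.colLen c) r (by omega) (by omega) (by omega)
      omega

/-- In a nonempty column which is not pure, the bottom is `i+1`, and there is a surviving `i`. -/
theorem pcm_mixed (hT : IsSkewRPP lam mu (i + 1) T)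
    (hband : ∀ r c, IsSkewCell lam mu r c → InBand i (T r c)) (c : ℕ)
    (hc : mu.colLen c < lam.colLen c)
    (hp : ¬ (IsPureLow i lam mu T c ∨ IsPureHigh i lam mu T c)) :
    T (lam.colLen c - 1) c = i + 1 ∧
      ∃ r, mu.colLen c ≤ r ∧ r + 1 < lam.colLen c ∧ T r c = i ∧ T (r + 1) c = i + 1 := by
  rw [pcm_pureLow hT hband, pcm_pureHigh hT hband] at hp
  have hb : T (lam.colLen c - 1) c = i + 1 := by
    rcases pcm_band hband (lam.colLen c - 1) c (by omega) (by omega) with h | h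
    · exact (hp (Or.inl ⟨hc, h⟩)).elim
    · exact h
  have ht : T (mu.colLen c) c = i := by
    rcases pcm_band hband (mu.colLen c) c (by omega) (by omega) with h | h
    · exact h
    · exact (hp (Or.inr ⟨hc, h⟩)).elim
  refine ⟨hb, ?_⟩
  by_contra hno
  push Not at hno
  have : ∀ r, mu.colLen c ≤ r → r < lam.colLen c → T r c = i := by
    intro r hr
    induction r, hr using Nat.le_induction with
    | base => intro _; exact ht
    | succ s hs ih =>
      intro hlt
      have := hno s hs hlt (ih (by omega))
      rcases pcm_band hband (s + 1) c (by omega) hlt with h | h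
      · exact h
      · exact (this h).elim
  have := this (lam.colLen c - 1) (by omega) (by omega)
  omega

theorem pcm_P_false (x : ℕ × ℕ) : pcmP i lam mu T x = false ↔
    ¬ (IsPureLow i lam mu T x.2 ∨ IsPureHigh i lam mu T x.2) := by
  simp [pcmP]

theorem pcm_P_true (x : ℕ × ℕ) : pcmP i lam mu T x = true ↔
    (IsPureLow i lam mu T x.2 ∨ IsPureHigh i lam mu T x.2) := by
  simp [pcmP]

/-- Columns of the surviving cells in mixed columns, of value `v`, among the first `q`. -/
def pcmMix (i : ℕ) (lam mu : YoungDiagram) (T : ℕ → ℕ → ℕ) (v q : ℕ) : List ℕ :=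
  (((pcmCells lam mu T).take q).filter fun x =>
    (!pcmP i lam mu T x) && decide (T x.1 x.2 = v)).map Prod.snd

theorem pcm_mem_mix (v q c : ℕ) : c ∈ pcmMix i lam mu T v q ↔
    ∃ r, (r, c) ∈ (pcmCells lam mu T).take q ∧
      ¬ (IsPureLow i lam mu T c ∨ IsPureHigh i lam mu T c) ∧ T r c = v := by
  unfold pcmMix
  simp only [List.mem_map, List.mem_filter, Bool.and_eq_true, Bool.not_eq_true', pcm_P_false,
    decide_eq_true_eq, Prod.exists, exists_eq_right]

theorem pcm_count_split {α : Type} (P : α → Bool) (f : α → ℕ) (v : ℕ) (l : List α) :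
    (l.map f).count v = ((l.filter P).map f).count v +
      (l.filter fun x => (!P x) && decide (f x = v)).length := by
  induction l with
  | nil => simp
  | cons a l ih =>
    by_cases h1 : P a <;> by_cases h2 : f a = v <;>
      simp [h1, h2, ih] <;> omega

theorem pcm_prefD_split (q : ℕ) :
    prefD i (((pcmCells lam mu T).filter (pcmP i lam mu T)).map fun x => T x.1 x.2)
        (pcmKap (pcmP i lam mu T) (pcmCells lam mu T) q) =
      prefD i ((pcmCells lam mu T).map fun x => T x.1 x.2) q +
        (pcmMix i lam mu T (i + 1) q).length - (pcmMix i lam mu T i q).length := by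
  unfold prefD pcmMix
  rw [← List.map_take, pcm_take_kap, ← List.map_take,
    pcm_count_split (pcmP i lam mu T) (fun x => T x.1 x.2) i ((pcmCells lam mu T).take q),
    pcm_count_split (pcmP i lam mu T) (fun x => T x.1 x.2) (i + 1) ((pcmCells lam mu T).take q),
    List.length_map, List.length_map]
  push_cast
  ring

theorem pcm_surv_unique (hT : IsSkewRPP lam mu (i + 1) T)
    (hband : ∀ r c, IsSkewCell lam mu r c → InBand i (T r c)) (r r' c : ℕ)
    (hs : Survives lam mu T r c) (hs' : Survives lam mu T r' c)
    (hp : ¬ (IsPureLow i lam mu T c ∨ IsPureHigh i lam mu T c))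
    (he : T r c = T r' c) : r = r' := by
  rw [pcm_surv hT hband] at hs hs'
  have hb := (pcm_mixed hT hband c (by omega) hp).1
  have key : ∀ s s', s < s' → mu.colLen c ≤ s → s' < lam.colLen c → T s c = T s' c →
      T (s + 1) c = T s c := by
    intro s s' h h1 h2 h3
    have := pcm_col_mono hT c s (s + 1) (by omega) h1 (by omega)
    have := pcm_col_mono hT c (s + 1) s' (by omega) (by omega) (by omega)
    omega
  rcases lt_trichotomy r r' with h | h | h
  · have := key r r' h (by omega) (by omega) he
    omega
  · exact h
  · have := key r' r h (by omega) (by omega) he.symm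
    omega

theorem pcm_mix_nodup (hT : IsSkewRPP lam mu (i + 1) T)
    (hband : ∀ r c, IsSkewCell lam mu r c → InBand i (T r c)) (v q : ℕ) :
    (pcmMix i lam mu T v q).Nodup := by
  unfold pcmMix
  refine List.Nodup.map_on ?_
    (((pcm_nodup lam mu T).sublist (List.take_sublist _ _)).filter _)
  rintro ⟨r, c⟩ hx ⟨r', c'⟩ hy hxy
  simp only [List.mem_filter, Bool.and_eq_true, Bool.not_eq_true', pcm_P_false,
    decide_eq_true_eq] at hx hy hxy
  subst hxy
  have h1 := (pcm_mem_cells lam mu T _).1 (List.mem_of_mem_take hx.1)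
  have h2 := (pcm_mem_cells lam mu T _).1 (List.mem_of_mem_take hy.1)
  rw [pcm_surv_unique hT hband r r' c h1 h2 hx.2.1 (hx.2.2.trans hy.2.2.symm)]

theorem pcm_mix_sub (hT : IsSkewRPP lam mu (i + 1) T)
    (hband : ∀ r c, IsSkewCell lam mu r c → InBand i (T r c)) (q : ℕ) :
    pcmMix i lam mu T i q ⊆ pcmMix i lam mu T (i + 1) q := by
  intro c hc
  rw [pcm_mem_mix] at hc ⊢
  obtain ⟨r, h1, h2, h3⟩ := hc
  have hs := (pcm_mem_cells lam mu T _).1 (List.mem_of_mem_take h1)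
  simp only [pcm_surv hT hband] at hs
  have hb := (pcm_mixed hT hband c (by omega) h2).1
  refine ⟨lam.colLen c - 1, ?_, h2, hb⟩
  refine pcm_take_closed lam mu T q _ _ h1 ?_ ?_
  · rw [pcm_mem_cells]
    simp only [pcm_surv hT hband]
    omega
  · left
    have : r ≠ lam.colLen c - 1 := by rintro rfl; omega
    show r < lam.colLen c - 1
    omega

theorem pcm_h0 (hT : IsSkewRPP lam mu (i + 1) T)
    (hband : ∀ r c, IsSkewCell lam mu r c → InBand i (T r c)) (q : ℕ) :
    prefD i ((pcmCells lam mu T).map fun x => T x.1 x.2) q ≤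
    prefD i (((pcmCells lam mu T).filter (pcmP i lam mu T)).map fun x => T x.1 x.2)
        (pcmKap (pcmP i lam mu T) (pcmCells lam mu T) q) := by
  rw [pcm_prefD_split]
  have := (List.subperm_of_subset (pcm_mix_nodup hT hband i q)
    (pcm_mix_sub hT hband q)).length_le
  omega

theorem pcm_h1 (hT : IsSkewRPP lam mu (i + 1) T)
    (hband : ∀ r c, IsSkewCell lam mu r c → InBand i (T r c)) (p : ℕ) (x : ℕ × ℕ)
    (hx : (pcmCells lam mu T)[p]? = some x) (hP : pcmP i lam mu T x = true)
    (hf : T x.1 x.2 = i) :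
    prefD i (((pcmCells lam mu T).filter (pcmP i lam mu T)).map fun x => T x.1 x.2)
        (pcmKap (pcmP i lam mu T) (pcmCells lam mu T) p) ≤
    prefD i ((pcmCells lam mu T).map fun x => T x.1 x.2) p := by
  rw [pcm_prefD_split]
  have hsub : pcmMix i lam mu T (i + 1) p ⊆ pcmMix i lam mu T i p := by
    intro c hc
    rw [pcm_mem_mix] at hc ⊢
    obtain ⟨r, h1, h2, h3⟩ := hc
    obtain ⟨h1, hbef⟩ := (pcm_mem_take lam mu T p x _ hx).1 h1
    have hs := (pcm_mem_cells lam mu T _).1 h1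
    have hsx := (pcm_mem_cells lam mu T _).1 (List.mem_of_getElem? hx)
    have hxb := pcm_pure_surv hT hband _ _ hsx ((pcm_P_true x).1 hP)
    obtain ⟨b, c'⟩ := x
    simp only [pcm_surv hT hband] at hs hsx hxb hf
    obtain ⟨-, s, hs1, hs2, hs3, hs4⟩ := pcm_mixed hT hband c (by omega) h2
    have hcc : c < c' := by
      by_contra hlt
      have a1 := lam.colLen_anti c' c (by omega)
      unfold pcmBef at hbef
      simp only at hbef
      omega
    have a1 := lam.colLen_anti c c' (by omega)
    refine ⟨s, ?_, h2, hs3⟩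
    rw [pcm_mem_take lam mu T p _ _ hx, pcm_mem_cells]
    simp only [pcm_surv hT hband]
    refine ⟨⟨hs1, Or.inr ⟨hs2, hs3, hs4⟩⟩, ?_⟩
    unfold pcmBef
    simp only
    by_contra hno
    have b1 := pcm_col_mono hT c (s + 1) b (by omega) (by omega) (by omega)
    have b2 := pcm_row_mono hT b c c' (by omega) (by omega) (by omega)
    omega
  have := (List.subperm_of_subset (pcm_mix_nodup hT hband (i + 1) p) hsub).length_le
  omega

theorem pcm_h2 (hT : IsSkewRPP lam mu (i + 1) T)
    (hband : ∀ r c, IsSkewCell lam mu r c → InBand i (T r c)) (p : ℕ) (x : ℕ × ℕ)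
    (hx : (pcmCells lam mu T)[p]? = some x) (hP : pcmP i lam mu T x = false)
    (hf : T x.1 x.2 = i) :
    prefD i ((pcmCells lam mu T).map fun x => T x.1 x.2) p <
    prefD i (((pcmCells lam mu T).filter (pcmP i lam mu T)).map fun x => T x.1 x.2)
        (pcmKap (pcmP i lam mu T) (pcmCells lam mu T) p) := by
  rw [pcm_prefD_split]
  rw [pcm_P_false] at hP
  have hsx := (pcm_mem_cells lam mu T _).1 (List.mem_of_getElem? hx)
  obtain ⟨r, c⟩ := x
  simp only at hsx hP hf
  have hnot : c ∉ pcmMix i lam mu T i p := by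
    rw [pcm_mem_mix]
    rintro ⟨r', h1, -, h3⟩
    obtain ⟨h1, hbef⟩ := (pcm_mem_take lam mu T p _ _ hx).1 h1
    have hs := (pcm_mem_cells lam mu T _).1 h1
    have := pcm_surv_unique hT hband r r' c hsx hs hP (by omega)
    subst this
    exact pcm_bef_asymm hbef hbef
  have hin : c ∈ pcmMix i lam mu T (i + 1) p := by
    rw [pcm_mem_mix]
    rw [pcm_surv hT hband] at hsx
    have hb := (pcm_mixed hT hband c (by omega) hP).1
    refine ⟨lam.colLen c - 1, ?_, hP, hb⟩
    rw [pcm_mem_take lam mu T p _ _ hx, pcm_mem_cells]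
    simp only [pcm_surv hT hband]
    refine ⟨by omega, Or.inl ?_⟩
    have : r ≠ lam.colLen c - 1 := by rintro rfl; omega
    show r < lam.colLen c - 1
    omega
  have hsub : c :: pcmMix i lam mu T i p ⊆ pcmMix i lam mu T (i + 1) p := by
    intro d hd
    rcases List.mem_cons.1 hd with rfl | hd
    · exact hin
    · exact pcm_mix_sub hT hband p hd
  have := (List.subperm_of_subset
    (List.nodup_cons.2 ⟨hnot, pcm_mix_nodup hT hband i p⟩) hsub).length_le
  rw [List.length_cons] at this
  omega

theorem pcm_pureCols (hT : IsSkewRPP lam mu (i + 1) T)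
    (hband : ∀ r c, IsSkewCell lam mu r c → InBand i (T r c)) :
    pureCols i lam mu T =
      ((pcmCells lam mu T).filter (pcmP i lam mu T)).map Prod.snd := by
  apply List.SortedLT.eq_of_mem_iff
  · exact (List.Pairwise.filter _ List.pairwise_lt_range).sortedLT
  · refine List.Pairwise.sortedLT ?_
    rw [List.pairwise_map]
    refine ((pcm_pairwise lam mu T).filter _).imp_of_mem ?_
    intro x y hx hy hb
    rw [List.mem_filter, pcm_P_true, pcm_mem_cells] at hx hy
    have h1 := pcm_pure_surv hT hband _ _ hx.1 hx.2
    have h2 := pcm_pure_surv hT hband _ _ hy.1 hy.2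
    by_contra hlt
    have := lam.colLen_anti y.2 x.2 (by omega)
    unfold pcmBef at hb
    omega
  · intro c
    unfold pureCols
    simp only [List.mem_filter, List.mem_range, List.mem_map, Bool.or_eq_true, decide_eq_true_eq,
      pcm_P_true, pcm_mem_cells, Prod.exists, exists_eq_right]
    constructor
    · rintro ⟨h1, h2⟩
      refine ⟨lam.colLen c - 1, ?_, h2⟩
      rw [pcm_pureLow hT hband, pcm_pureHigh hT hband] at h2
      rw [pcm_surv hT hband]
      omega
    · rintro ⟨r, h1, h2⟩
      refine ⟨?_, h2⟩
      rw [← YoungDiagram.mem_iff_lt_rowLen, YoungDiagram.mem_iff_lt_colLen]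
      rw [pcm_surv hT hband] at h1
      omega

theorem pcm_colWord (hT : IsSkewRPP lam mu (i + 1) T)
    (hband : ∀ r c, IsSkewCell lam mu r c → InBand i (T r c)) :
    colWord i lam mu T =
      ((pcmCells lam mu T).filter (pcmP i lam mu T)).map fun x => T x.1 x.2 := by
  unfold colWord
  rw [pcm_pureCols hT hband, List.map_map]
  refine List.map_congr_left ?_
  intro x hx
  rw [List.mem_filter, pcm_P_true, pcm_mem_cells] at hx
  have h1 := pcm_pure_surv hT hband _ _ hx.1 hx.2
  have h2 := hx.1.1
  rw [pcm_cell_iff] at h2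
  have h3 := pcm_band hband _ _ h2.1 h2.2
  have h4 : lam.colLen x.2 - 1 = x.1 := by omega
  simp only [Function.comp]
  have hlow := pcm_pureLow hT hband x.2
  rw [h4] at hlow
  split_ifs with h <;> rw [hlow] at h
  · exact h.2.symm
  · have : T x.1 x.2 ≠ i := fun h' => h ⟨by omega, h'⟩
    omega

/-- A pure column's bottom cell occurs in the list of surviving cells. -/
theorem pcm_pure_pos (hT : IsSkewRPP lam mu (i + 1) T)
    (hband : ∀ r c, IsSkewCell lam mu r c → InBand i (T r c)) (c : ℕ)
    (hp : IsPureLow i lam mu T c ∨ IsPureHigh i lam mu T c) :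
    (pcmCells lam mu T)[posOf lam mu T (colBtm lam mu c) c]? = some (colBtm lam mu c, c) ∧
      colBtm lam mu c + 1 = lam.colLen c := by
  have hc : mu.colLen c < lam.colLen c := by
    rw [pcm_pureLow hT hband, pcm_pureHigh hT hband] at hp
    omega
  have hb := pcm_btm lam mu c hc
  have hm : (colBtm lam mu c, c) ∈ pcmCells lam mu T := by
    rw [pcm_mem_cells]
    simp only [pcm_surv hT hband]
    omega
  obtain ⟨p, hpp⟩ := List.mem_iff_getElem?.1 hm
  have := pcm_posOf lam mu T p _ hpp
  simp only at this
  rw [this]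
  exact ⟨hpp, by omega⟩

/-- The index of a pure column is the number of selected cells before its bottom cell. -/
theorem pcm_pure_kap (hT : IsSkewRPP lam mu (i + 1) T)
    (hband : ∀ r c, IsSkewCell lam mu r c → InBand i (T r c)) (k c : ℕ)
    (hk : (pureCols i lam mu T)[k]? = some c) :
    (IsPureLow i lam mu T c ∨ IsPureHigh i lam mu T c) ∧
      pcmKap (pcmP i lam mu T) (pcmCells lam mu T) (posOf lam mu T (colBtm lam mu c) c) = k := by
  have hm := List.mem_of_getElem? hk
  have hp : IsPureLow i lam mu T c ∨ IsPureHigh i lam mu T c := by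
    unfold pureCols at hm
    simpa using (List.mem_filter.1 hm).2
  refine ⟨hp, ?_⟩
  obtain ⟨h1, -⟩ := pcm_pure_pos hT hband c hp
  have h2 := pcm_kap_get (pcmP i lam mu T) _ _ _ h1 ((pcm_P_true _).2 hp)
  have h3 : (pureCols i lam mu T)[pcmKap (pcmP i lam mu T) (pcmCells lam mu T)
      (posOf lam mu T (colBtm lam mu c) c)]? = some c := by
    rw [pcm_pureCols hT hband, List.getElem?_map, h2]
    rfl
  have hnd : (pureCols i lam mu T).Nodup := List.Nodup.filter _ List.nodup_range
  have hlt := (List.getElem?_eq_some_iff.1 h3).1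
  exact (List.getElem?_inj hlt hnd).1 (h3.trans hk.symm)

end Tab

/-- Let `T` be a reverse plane partition of shape `lam/mu` all of whose
entries are `i` or `i+1`. An `i`-pure column of `T` is unmatched in the column parenthesis
matching of `T` iff the entry of the reading word `r(T)` contributed by that column is
unmatched in the parenthesis matching of `r(T)`; the order of the pure columns agrees with
the order of their contributed entries in `r(T)`; and the unmatched `i`-pure columns
correspond exactly, in left-to-right order, to the unmatched `i`'s of `r(T)`. -/
theorem pure_column_matching (i : ℕ) (hi : 1 ≤ i) (lam mu : YoungDiagram) (hsub : mu ≤ lam)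
    (T : ℕ → ℕ → ℕ) (hT : IsSkewRPP lam mu (i + 1) T)
    (hband : ∀ r c, IsSkewCell lam mu r c → InBand i (T r c)) :
    (∀ k c, (pureCols i lam mu T)[k]? = some c → IsPureLow i lam mu T c →
      (IsUnmatchedClose i (colWord i lam mu T) k ↔
        IsUnmatchedClose i (readingWord lam mu T) (posOf lam mu T (colBtm lam mu c) c))) ∧
    (∀ c c', c < c' →
      (IsPureLow i lam mu T c ∨ IsPureHigh i lam mu T c) →
      (IsPureLow i lam mu T c' ∨ IsPureHigh i lam mu T c') →
      posOf lam mu T (colBtm lam mu c) c < posOf lam mu T (colBtm lam mu c') c') ∧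
    (unmatchedCloses i (readingWord lam mu T) =
      (unmatchedCloses i (colWord i lam mu T)).map fun k =>
        posOf lam mu T (colBtm lam mu ((pureCols i lam mu T).getD k 0))
          ((pureCols i lam mu T).getD k 0)) := by
  have habs := pcm_abstract i (pcmP i lam mu T) (fun x => T x.1 x.2) (pcmCells lam mu T)
    (fun x hx => hband _ _ ((pcm_mem_cells lam mu T x).1 hx).1)
    (pcm_h0 hT hband) (pcm_h1 hT hband) (pcm_h2 hT hband)
  rw [← pcm_readingWord, ← pcm_colWord hT hband] at habs
  have part1 : ∀ k c, (pureCols i lam mu T)[k]? = some c →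
      (IsUnmatchedClose i (colWord i lam mu T) k ↔
        IsUnmatchedClose i (readingWord lam mu T) (posOf lam mu T (colBtm lam mu c) c)) := by
    intro k c hk
    obtain ⟨hp, hkap⟩ := pcm_pure_kap hT hband k c hk
    have h := habs _ _ (pcm_pure_pos hT hband c hp).1
    rw [hkap, pcm_P_true] at h
    rw [h]
    exact ⟨fun h' => ⟨hp, h'⟩, fun h' => h'.2⟩
  have part2 : ∀ c c', c < c' →
      (IsPureLow i lam mu T c ∨ IsPureHigh i lam mu T c) →
      (IsPureLow i lam mu T c' ∨ IsPureHigh i lam mu T c') →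
      posOf lam mu T (colBtm lam mu c) c < posOf lam mu T (colBtm lam mu c') c' := by
    intro c c' hcc hp hp'
    obtain ⟨h1, h2⟩ := pcm_pure_pos hT hband c hp
    obtain ⟨h3, h4⟩ := pcm_pure_pos hT hband c' hp'
    have hanti := lam.colLen_anti c c' hcc.le
    have hmem : (colBtm lam mu c, c) ∈
        (pcmCells lam mu T).take (posOf lam mu T (colBtm lam mu c') c') := by
      rw [pcm_mem_take lam mu T _ _ _ h3]
      refine ⟨List.mem_of_getElem? h1, ?_⟩
      unfold pcmBef
      simp only
      omega
    obtain ⟨p, hp⟩ := List.mem_iff_getElem?.1 hmem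
    have hlt := (List.getElem?_eq_some_iff.1 hp).1
    rw [List.length_take] at hlt
    rw [List.getElem?_take_of_lt (by omega)] at hp
    have := pcm_posOf lam mu T p _ hp
    simp only at this
    omega
  refine ⟨fun k c hk _ => part1 k c hk, part2, ?_⟩
  have hlen : (colWord i lam mu T).length = (pureCols i lam mu T).length := by
    simp [colWord]
  have hget : ∀ k, k < (colWord i lam mu T).length →
      (pureCols i lam mu T)[k]? = some ((pureCols i lam mu T).getD k 0) := by
    intro k hk
    rw [hlen] at hk
    simp [List.getD, hk]
  apply List.SortedLT.eq_of_mem_iff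
  · exact (List.Pairwise.filter _ List.pairwise_lt_range).sortedLT
  · refine List.Pairwise.sortedLT ?_
    rw [List.pairwise_map]
    unfold unmatchedCloses
    refine (List.Pairwise.filter _ List.pairwise_lt_range).imp_of_mem ?_
    intro a b ha hb hab
    have ha' := hget a (List.mem_range.1 (List.mem_filter.1 ha).1)
    have hb' := hget b (List.mem_range.1 (List.mem_filter.1 hb).1)
    refine part2 _ _ ?_ (pcm_pure_kap hT hband _ _ ha').1 (pcm_pure_kap hT hband _ _ hb').1
    have hsort : (pureCols i lam mu T).Pairwise (· < ·) :=
      List.Pairwise.filter _ List.pairwise_lt_range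
    obtain ⟨hla, hea⟩ := List.getElem?_eq_some_iff.1 ha'
    obtain ⟨hlb, heb⟩ := List.getElem?_eq_some_iff.1 hb'
    rw [← hea, ← heb]
    exact List.pairwise_iff_getElem.1 hsort a b hla hlb hab
  · intro p
    simp only [unmatchedCloses, List.mem_filter, List.mem_range, List.mem_map, decide_eq_true_eq]
    constructor
    · rintro ⟨hlt, hun⟩
      have hlt' : p < (pcmCells lam mu T).length := by
        simpa [pcm_readingWord] using hlt
      have hx : (pcmCells lam mu T)[p]? = some (pcmCells lam mu T)[p] := by simp [hlt']
      set x := (pcmCells lam mu T)[p] with hxdef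
      obtain ⟨hP, hcl⟩ := (habs p x hx).1 hun
      have hkg := pcm_kap_get _ _ _ _ hx hP
      have hkg' : (pureCols i lam mu T)[pcmKap (pcmP i lam mu T) (pcmCells lam mu T) p]? =
          some x.2 := by
        rw [pcm_pureCols hT hband, List.getElem?_map, hkg]
        rfl
      have hklt := (List.getElem?_eq_some_iff.1 hkg').1
      refine ⟨_, ⟨by rw [hlen]; exact hklt, hcl⟩, ?_⟩
      have hgd : (pureCols i lam mu T).getD
          (pcmKap (pcmP i lam mu T) (pcmCells lam mu T) p) 0 = x.2 := by
        simp [List.getD, hkg']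
      rw [hgd]
      have hpx := (pcm_P_true x).1 hP
      have hb := (pcm_pure_pos hT hband x.2 hpx).2
      have hb' := pcm_pure_surv hT hband x.1 x.2
        ((pcm_mem_cells lam mu T x).1 (List.mem_of_getElem? hx)) hpx
      have : colBtm lam mu x.2 = x.1 := by omega
      rw [this]
      exact pcm_posOf lam mu T p x hx
    · rintro ⟨k, ⟨hlt, hun⟩, rfl⟩
      have hk := hget k hlt
      have h := (part1 k _ hk).1 hun
      refine ⟨?_, h⟩
      exact (List.getElem?_eq_some_iff.1 h.1).1
end
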